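/- Extremal eigenvalues are square roots of the largest degrees. Under assumptions (A1) and (A2), for every ν > 0 there exists a constant C_ν > 0 such that with ν-high probability, for every i ∈ [N]: if λ_i(A) > C_ν √(log N / log log N) then |λ_i(A) − √(D_{π(i)})| ≤ C_ν √(log N / log log N); and if λ_i(A) < −C_ν √(log N / log log N) then |λ_i(A) + √(D_{π(N+1−i)})| ≤ C_ν √(log N / log log N). -/

import Mathlib

open MeasureTheory Real

namespace GRG

variable {N : ℕ}

/-! ### Generic graph-theoretic definitions over an adjacency relation on `Fin N` -/

/-- The degree of a vertex with respect to an adjacency relation. -/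
noncomputable def degA (A : Fin N → Fin N → Prop) (x : Fin N) : ℕ :=
  {y | A x y}.ncard

/-- The strict total order `≺`: `x ≺ y` iff `D_x < D_y`, or `D_x = D_y` and `x > y`. -/
def precA (A : Fin N → Fin N → Prop) (x y : Fin N) : Prop :=
  degA A x < degA A y ∨ (degA A x = degA A y ∧ y < x)

/-- `γ 0, γ 1, …, γ l` is a path for the adjacency relation `A`. -/
def IsPathOn (A : Fin N → Fin N → Prop) (l : ℕ) (γ : ℕ → Fin N) : Prop :=
  ∀ i < l, A (γ i) (γ (i + 1))

/-- A path of length `l` is simple: all vertices distinct except possibly endpoints. -/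
def IsSimplePath (l : ℕ) (γ : ℕ → Fin N) : Prop :=
  ∀ i j, i < j → j ≤ l → ¬(i = 0 ∧ j = l) → γ i ≠ γ j

/-- Two paths are edge-disjoint. -/
def EdgeDisjoint (l l' : ℕ) (γ γ' : ℕ → Fin N) : Prop :=
  ∀ i < l, ∀ j < l',
    ¬((γ i = γ' j ∧ γ (i + 1) = γ' (j + 1)) ∨ (γ i = γ' (j + 1) ∧ γ (i + 1) = γ' j))

/-- `S_1^cyc(x)`: neighbours of `x` that start a simple cycle through `x`
of length at most `2r+1`. -/
def S1cycA (A : Fin N → Fin N → Prop) (r : ℕ) (x : Fin N) : Set (Fin N) :=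
  {y | A x y ∧ ∃ l γ, 3 ≤ l ∧ l ≤ 2 * r + 1 ∧ γ 0 = x ∧ γ 1 = y ∧ γ l = x ∧
    IsPathOn A l γ ∧ IsSimplePath l γ}

/-- `S_1^du(x)`: neighbours `y ∉ S_1^cyc(x)` of `x` that have a neighbour
`z ∉ S_1^cyc(y)` with `y ≺ x ≺ z`. -/
def S1duA (A : Fin N → Fin N → Prop) (r : ℕ) (x : Fin N) : Set (Fin N) :=
  {y | A x y ∧ y ∉ S1cycA A r x ∧ precA A y x ∧
    ∃ z, A y z ∧ z ∉ S1cycA A r y ∧ precA A x z}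

/-- Adjacency in the graph `G^nc` (after removing the cycle-creating edges). -/
def AdjNCA (A : Fin N → Fin N → Prop) (r : ℕ) (x y : Fin N) : Prop :=
  A x y ∧ y ∉ S1cycA A r x ∧ x ∉ S1cycA A r y

/-- Adjacency in the pruned graph `G^p` (after further removing the down-up edges). -/
def AdjPA (A : Fin N → Fin N → Prop) (r : ℕ) (x y : Fin N) : Prop :=
  AdjNCA A r x y ∧ y ∉ S1duA A r x ∧ x ∉ S1duA A r y

/-- Degree in the pruned graph. -/
noncomputable def degPA (A : Fin N → Fin N → Prop) (r : ℕ) (x : Fin N) : ℕ :=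
  {y | AdjPA A r x y}.ncard

/-- `S_1^{p−}(x)`: pruned-graph neighbours of `x` that are smaller than `x` for `≺`. -/
def S1pmA (A : Fin N → Fin N → Prop) (r : ℕ) (x : Fin N) : Set (Fin N) :=
  {y | AdjPA A r x y ∧ precA A y x}

/-- `D_x^{p−}`. -/
noncomputable def degPmA (A : Fin N → Fin N → Prop) (r : ℕ) (x : Fin N) : ℕ :=
  (S1pmA A r x).ncard

/-- `Sib^−(x)`: the smaller siblings of `x` (children of the parent of `x`
that are smaller than `x`). -/
def SibmA (A : Fin N → Fin N → Prop) (r : ℕ) (x : Fin N) : Set (Fin N) :=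
  {y | ∃ p, AdjPA A r x p ∧ precA A x p ∧ AdjPA A r p y ∧ precA A y p ∧ precA A y x}

/-- The normalization constant `Z_x` (note `2/0 = 0` in Lean, so this agrees with the
convention `Z_x = 2` when `Sib^−(x) = ∅`). -/
noncomputable def ZxA (A : Fin N → Fin N → Prop) (r : ℕ) (x : Fin N) : ℝ :=
  2 + 2 / (SibmA A r x).ncard

/-- The indicator vector of a set of vertices. -/
noncomputable def indVec (S : Set (Fin N)) : Fin N → ℝ :=
  S.indicator 1

/-- The approximate eigenvector `u_σ(x)`. -/
noncomputable def uVecA (A : Fin N → Fin N → Prop) (r : ℕ) (σ : ℝ) (x : Fin N) :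
    Fin N → ℝ := fun y =>
  (Real.sqrt (ZxA A r x))⁻¹ *
    (indVec {x} y + σ * (Real.sqrt (degPmA A r x))⁻¹ * indVec (S1pmA A r x) y -
      indVec (SibmA A r x) y / (SibmA A r x).ncard)

/-- The star vector `v_σ(x)`. -/
noncomputable def vVecA (A : Fin N → Fin N → Prop) (r : ℕ) (σ : ℝ) (x : Fin N) :
    Fin N → ℝ := fun y =>
  (Real.sqrt 2)⁻¹ *
    (indVec {x} y + σ * (Real.sqrt (degPmA A r x))⁻¹ * indVec (S1pmA A r x) y)

/-- Euclidean scalar product on `ℝ^N`. -/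
noncomputable def dotR (f g : Fin N → ℝ) : ℝ := ∑ y, f y * g y

/-- The Euclidean (`ℓ² → ℓ²`) operator norm of an `N × N` real matrix. -/
noncomputable def opNorm (M : Matrix (Fin N) (Fin N) ℝ) : ℝ :=
  ‖Matrix.toEuclideanCLM (𝕜 := ℝ) M‖

open Classical in
/-- The adjacency matrix of the pruned graph. -/
noncomputable def adjMatrixPA (A : Fin N → Fin N → Prop) (r : ℕ) :
    Matrix (Fin N) (Fin N) ℝ := fun x y => if AdjPA A r x y then 1 else 0

/-- The threshold `ξ_ν`. -/
noncomputable def xi (ν δ : ℝ) (N : ℕ) : ℝ :=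
  3 * (ν + 1) * (2 - 3 * δ) / ((1 - δ) * (1 - 2 * δ)) *
    (Real.log N / Real.log (Real.log N))

/-- The set `V_ν^{(h)}` of high-degree vertices. -/
def VhA (A : Fin N → Fin N → Prop) (ν δ : ℝ) : Set (Fin N) :=
  {x | xi ν δ N ≤ (degA A x : ℝ)}

/-- The projection `Π^p` onto the span of the vectors `u_σ(x)`, `x ∈ V_ν^{(h)}`. -/
noncomputable def PiPA (A : Fin N → Fin N → Prop) (r : ℕ) (ν δ : ℝ) :
    Matrix (Fin N) (Fin N) ℝ :=
  ∑ x : Fin N, Set.indicator (VhA A ν δ) (fun _ => (1 : ℝ)) x •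
    (Matrix.vecMulVec (uVecA A r 1 x) (uVecA A r 1 x) +
      Matrix.vecMulVec (uVecA A r (-1) x) (uVecA A r (-1) x))

/-- The block-diagonal approximation `Â`. -/
noncomputable def AhatA (A : Fin N → Fin N → Prop) (r : ℕ) (ν δ : ℝ) :
    Matrix (Fin N) (Fin N) ℝ :=
  (∑ x : Fin N, Set.indicator (VhA A ν δ) (fun _ => (1 : ℝ)) x •
    (Real.sqrt (degPmA A r x) •
      (Matrix.vecMulVec (uVecA A r 1 x) (uVecA A r 1 x) -
        Matrix.vecMulVec (uVecA A r (-1) x) (uVecA A r (-1) x)))) +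
  (1 - PiPA A r ν δ) * adjMatrixPA A r * (1 - PiPA A r ν δ)

/-! ### The generalized random graph (GRG) model -/

/-- Index set of potential edges. -/
abbrev EdgeIdx (N : ℕ) := {p : Fin N × Fin N // p.1 < p.2}

/-- The edge probabilities `p_{xy} = w_x w_y / (Σ_z w_z + w_x w_y)`. -/
noncomputable def pGRG (w : Fin N → ℝ) (x y : Fin N) : ℝ :=
  w x * w y / ((∑ z, w z) + w x * w y)

/-- Bernoulli measure with parameter `p` on `Bool`. -/
noncomputable def bern (p : ℝ) : Measure Bool :=
  ENNReal.ofReal p • Measure.dirac true + ENNReal.ofReal (1 - p) • Measure.dirac false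

instance (p : ℝ) : IsFiniteMeasure (bern p) := by
  constructor
  simp only [bern, Measure.coe_add, Measure.coe_smul, Pi.add_apply, Pi.smul_apply,
    smul_eq_mul, measure_univ, mul_one]
  exact ENNReal.add_lt_top.mpr ⟨ENNReal.ofReal_lt_top, ENNReal.ofReal_lt_top⟩

/-- The law of the GRG: independent Bernoulli edge indicators. -/
noncomputable def grgMeasure (w : Fin N → ℝ) : Measure (EdgeIdx N → Bool) :=
  Measure.pi fun e => bern (pGRG w e.val.1 e.val.2)

/-- The (random) adjacency matrix. -/
noncomputable def adjMatrix (ω : EdgeIdx N → Bool) : Matrix (Fin N) (Fin N) ℝ :=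
  fun x y =>
    if h : x < y then (if ω ⟨(x, y), h⟩ then 1 else 0)
    else if h' : y < x then (if ω ⟨(y, x), h'⟩ then 1 else 0)
    else 0

/-- The (random) adjacency relation. -/
def Adj (ω : EdgeIdx N → Bool) (x y : Fin N) : Prop := adjMatrix ω x y = 1

/-- The (random) degree `D_x`. -/
noncomputable def deg (ω : EdgeIdx N → Bool) (x : Fin N) : ℕ := degA (Adj ω) x

/-- The first empirical moment `m_1`. -/
noncomputable def m1 (w : Fin N → ℝ) : ℝ := (∑ x, w x) / N

/-- The second empirical moment `m_2`. -/
noncomputable def m2 (w : Fin N → ℝ) : ℝ := (∑ x, w x ^ 2) / N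

/-- The expected degree `d_x = E[D_x]`. -/
noncomputable def dExp (w : Fin N → ℝ) (x : Fin N) : ℝ :=
  ∫ ω, (deg ω x : ℝ) ∂(grgMeasure w)

/-- The set `W_{λ,η}` of resonant vertices. -/
def resonant (ω : EdgeIdx N → Bool) (lam η : ℝ) : Set (Fin N) :=
  {x | |Real.sqrt (deg ω x) - lam| ≤ η}

/-- The set `V*_{ν,η}` of isolated vertices. -/
noncomputable def Vstar (w : Fin N → ℝ) (ν η : ℝ) : Set (Fin N) :=
  {x | (4 * ν / 9) * Real.log N ≤ dExp w x ∧
    ∀ y, y ≠ x →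
      max (4 * Real.sqrt (ν * Real.log N * dExp w x) +
            4 * Real.sqrt (ν * Real.log N * dExp w y))
          (16 * η ^ 2) ≤ |dExp w x - dExp w y|}

end GRG

namespace GRG

open Classical in
/-- Real-valued indicator of a proposition. -/
noncomputable def ind (P : Prop) : ℝ := if P then 1 else 0

lemma ind_nonneg (P : Prop) : 0 ≤ ind P := by unfold ind; split_ifs <;> norm_num
lemma ind_le_one (P : Prop) : ind P ≤ 1 := by unfold ind; split_ifs <;> norm_num
lemma ind_true {P : Prop} (h : P) : ind P = 1 := by simp [ind, h]
lemma ind_false {P : Prop} (h : ¬ P) : ind P = 0 := by simp [ind, h]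
lemma ind_mono {P Q : Prop} (h : P → Q) : ind P ≤ ind Q := by
  by_cases hp : P
  · rw [ind_true hp, ind_true (h hp)]
  · rw [ind_false hp]; exact ind_nonneg _

/-- Weighted Schur test for the quadratic form of a nonnegative kernel. -/
lemma schur {V : Type*} [Fintype V] (B t : V → V → ℝ) (K : ℝ)
    (hB : ∀ y x, 0 ≤ B y x) (ht : ∀ y x, B y x ≠ 0 → 0 < t y x)
    (hrow : ∀ y, ∑ x, B y x * t y x ≤ K) (hcol : ∀ x, ∑ y, B y x / t y x ≤ K) (v : V → ℝ) :
    |∑ y, ∑ x, B y x * v y * v x| ≤ K * ∑ x, v x ^ 2 := by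
  have h1 : |∑ y, ∑ x, B y x * v y * v x| ≤
      ∑ y, ∑ x, ((B y x * t y x) * v y ^ 2 / 2 + (B y x / t y x) * v x ^ 2 / 2) := by
    refine (Finset.abs_sum_le_sum_abs _ _).trans (Finset.sum_le_sum fun y _ => ?_)
    refine (Finset.abs_sum_le_sum_abs _ _).trans (Finset.sum_le_sum fun x _ => ?_)
    by_cases h : B y x = 0
    · simp [h]
    · have htp := ht y x h
      have hb := hB y x
      have key : |v y * v x| ≤ t y x * v y ^ 2 / 2 + (1 / t y x) * v x ^ 2 / 2 := by
        have e1 : t y x * v y ^ 2 / 2 + (1 / t y x) * v x ^ 2 / 2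
          = (t y x ^ 2 * v y ^ 2 + v x ^ 2) / (2 * t y x) := by field_simp
        rw [e1, le_div_iff₀ (by positivity), abs_mul]
        have := sq_nonneg (t y x * |v y| - |v x|)
        nlinarith [sq_abs (v y), sq_abs (v x)]
      calc |B y x * v y * v x| = B y x * |v y * v x| := by
            rw [mul_assoc, abs_mul, abs_of_nonneg hb]
        _ ≤ B y x * (t y x * v y ^ 2 / 2 + (1 / t y x) * v x ^ 2 / 2) :=
            mul_le_mul_of_nonneg_left key hb
        _ = _ := by ring
  refine h1.trans ?_
  simp_rw [Finset.sum_add_distrib]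
  have h2 : ∑ y, ∑ x, (B y x * t y x) * v y ^ 2 / 2 ≤ ∑ y, K * v y ^ 2 / 2 := by
    refine Finset.sum_le_sum fun y _ => ?_
    rw [← Finset.sum_div, ← Finset.sum_mul]
    have := mul_le_mul_of_nonneg_right (hrow y) (sq_nonneg (v y))
    linarith
  have h3 : ∑ y, ∑ x, (B y x / t y x) * v x ^ 2 / 2 ≤ ∑ y, K * v y ^ 2 / 2 := by
    rw [Finset.sum_comm]
    refine Finset.sum_le_sum fun y _ => ?_
    rw [← Finset.sum_div, ← Finset.sum_mul]
    have := mul_le_mul_of_nonneg_right (hcol y) (sq_nonneg (v y))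
    linarith
  have h4 : ∑ y, K * v y ^ 2 / 2 = K * (∑ y, v y ^ 2) / 2 := by
    rw [← Finset.sum_div, ← Finset.mul_sum]
  linarith

lemma rem_form {V : Type*} [Fintype V] (Rem : V → V → Prop) (In U : V → ℝ)
    (L C θi θo : ℝ) (hL : 0 < L) (hθi : 0 < θi) (hθo : 0 < θo)
    (hθ : θi * θo ≤ L ^ 2)
    (hIn : ∀ x, ∑ y, ind (Rem y x) = In x)
    (hU : ∀ y, ∑ x, ind (Rem y x) ≤ U y)
    (R1 : ∀ y, ∑ x, ind (Rem y x ∧ θi ≤ In x) * In x ≤ C * L ^ 2)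
    (R2 : ∀ x, ∑ y, ind (Rem y x ∧ θo ≤ U y) * U y ≤ C * L ^ 2) (v : V → ℝ) :
    |∑ y, ∑ x, ind (Rem y x) * v y * v x| ≤ (C + 2) * L * ∑ x, v x ^ 2 := by
  classical
  set t0 : ℝ := L / θo with ht0
  have ht0p : 0 < t0 := by positivity
  set t : V → V → ℝ := fun y x =>
    if θi ≤ In x then In x / L else if θo ≤ U y then L / U y else t0 with ht
  have hIn0 : ∀ x, 0 ≤ In x := fun x => by
    rw [← hIn]; exact Finset.sum_nonneg fun _ _ => ind_nonneg _
  have hU0 : ∀ x, 0 ≤ U x := fun x =>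
    le_trans (Finset.sum_nonneg fun _ _ => ind_nonneg _) (hU x)
  have htp : ∀ y x, 0 < t y x := by
    intro y x
    simp only [ht]
    split_ifs with h1 h2
    · have : 0 < In x := lt_of_lt_of_le hθi h1
      positivity
    · have : 0 < U y := lt_of_lt_of_le hθo h2
      positivity
    · exact ht0p
  refine schur (fun y x => ind (Rem y x)) t _ (fun _ _ => ind_nonneg _) (fun y x _ => htp y x)
    ?_ ?_ v
  · intro y
    have hle : ∀ x, ind (Rem y x) * t y x ≤
        ind (Rem y x ∧ θi ≤ In x) * In x / L
          + ind (Rem y x) * (if θo ≤ U y then L / U y else t0) := by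
      intro x
      have hpos : 0 ≤ (if θo ≤ U y then L / U y else t0) := by
        split_ifs
        · have := hU0 y; positivity
        · exact ht0p.le
      by_cases hR : Rem y x
      · by_cases h1 : θi ≤ In x
        · simp only [ht, h1, if_true, ind_true hR,
            one_mul, and_true]
          linarith
        · simp only [ht, h1, if_false, ind_true hR, one_mul]
          have := mul_nonneg (ind_nonneg (Rem y x ∧ False)) (hIn0 x)
          have := div_nonneg this hL.le
          linarith
      · rw [ind_false hR, ind_false (fun h => hR h.1)]; simp
    calc _ ≤ ∑ x, (ind (Rem y x ∧ θi ≤ In x) * In x / L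
          + ind (Rem y x) * (if θo ≤ U y then L / U y else t0)) :=
          Finset.sum_le_sum fun x _ => hle x
      _ = (∑ x, ind (Rem y x ∧ θi ≤ In x) * In x) / L
          + (∑ x, ind (Rem y x)) * (if θo ≤ U y then L / U y else t0) := by
          rw [Finset.sum_add_distrib, Finset.sum_div, Finset.sum_mul]
      _ ≤ C * L + L := by
          refine add_le_add ?_ ?_
          · rw [div_le_iff₀ hL]; nlinarith [R1 y]
          · split_ifs with h
            · have : 0 < U y := lt_of_lt_of_le hθo h
              calc _ ≤ U y * (L / U y) := mul_le_mul_of_nonneg_right (hU y) (by positivity)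
                _ = L := by field_simp
            · push Not at h
              calc _ ≤ θo * t0 := mul_le_mul_of_nonneg_right ((hU y).trans h.le) ht0p.le
                _ = L := by rw [ht0]; field_simp
      _ ≤ _ := by nlinarith
  · intro x
    have hle : ∀ y, ind (Rem y x) / t y x ≤
        ind (Rem y x ∧ θo ≤ U y) * U y / L
          + ind (Rem y x) * (if θi ≤ In x then L / In x else 1 / t0) := by
      intro y
      have hpos : 0 ≤ (if θi ≤ In x then L / In x else 1 / t0) := by
        split_ifs
        · have := hIn0 x; positivity
        · positivity
      have hq : 0 ≤ ind (Rem y x ∧ θo ≤ U y) * U y / L :=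
        div_nonneg (mul_nonneg (ind_nonneg _) (hU0 y)) hL.le
      by_cases hR : Rem y x
      · by_cases h1 : θi ≤ In x
        · simp only [ht, h1, if_true, ind_true hR, one_mul]
          rw [one_div_div]; linarith
        · by_cases h2 : θo ≤ U y
          · rw [ind_true (⟨hR, h2⟩ : Rem y x ∧ θo ≤ U y), ind_true hR]
            simp only [ht, h1, h2, if_false, if_true, one_mul]
            rw [one_div_div]
            have : 0 < 1 / t0 := by positivity
            linarith
          · simp only [ht, h1, h2, if_false, ind_true hR, one_mul]
            simp only [h2] at hq
            linarith
      · rw [ind_false hR, ind_false (fun h => hR h.1)]; simp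
    calc _ ≤ ∑ y, (ind (Rem y x ∧ θo ≤ U y) * U y / L
          + ind (Rem y x) * (if θi ≤ In x then L / In x else 1 / t0)) :=
          Finset.sum_le_sum fun x _ => hle x
      _ = (∑ y, ind (Rem y x ∧ θo ≤ U y) * U y) / L
          + In x * (if θi ≤ In x then L / In x else 1 / t0) := by
          rw [Finset.sum_add_distrib, Finset.sum_div, ← Finset.sum_mul, hIn]
      _ ≤ C * L + L := by
          refine add_le_add ?_ ?_
          · rw [div_le_iff₀ hL]; nlinarith [R2 x]
          · split_ifs with h
            · have : 0 < In x := lt_of_lt_of_le hθi h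
              exact le_of_eq (by field_simp)
            · push Not at h
              calc _ ≤ θi * (1 / t0) := mul_le_mul_of_nonneg_right h.le (by positivity)
                _ = θi * θo / L := by rw [ht0]; field_simp
                _ ≤ L := by rw [div_le_iff₀ hL]; nlinarith
      _ ≤ _ := by nlinarith

end GRG
namespace GRG

lemma uniq_sum {V : Type*} [Fintype V] (Par : V → V → Prop)
    (hp : ∀ y x x', Par y x → Par y x' → x = x') (f : V → ℝ) (y x : V) (h : Par y x) :
    ∑ x', ind (Par y x') * f x' = f x := by
  classical
  rw [Finset.sum_eq_single x]
  · rw [ind_true h, one_mul]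
  · intro b _ hb
    rw [ind_false (fun h' => hb (hp _ _ _ h' h)), zero_mul]
  · simp

lemma uniq_sum_le {V : Type*} [Fintype V] (Par : V → V → Prop)
    (hp : ∀ y x x', Par y x → Par y x' → x = x') (y : V) :
    ∑ x', ind (Par y x') ≤ 1 := by
  by_cases h : ∃ x, Par y x
  · obtain ⟨x, hx⟩ := h
    have := uniq_sum Par hp (fun _ => 1) y x hx
    simp only [mul_one] at this
    exact this.le
  · push Not at h
    rw [Finset.sum_eq_zero (fun x _ => ind_false (h x))]
    norm_num

set_option maxHeartbeats 1000000 in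
/-- Upper bound on the quadratic form of the forest on vertices of bounded degree. -/
lemma forest_upper {V : Type*} [Fintype V] (Par : V → V → Prop) (d : V → ℝ)
    (hp : ∀ y x x', Par y x → Par y x' → x = x')
    (hd : ∀ x, ∑ y, ind (Par y x) = d x)
    (L K : ℝ) (hL : 0 < L) (hK : 1 ≤ K)
    (h1 : ∀ y x, Par y x → d y ≤ d x / 4 + K * L ^ 2)
    (h2 : ∀ x, ∑ y, ind (Par y x) * d y ≤ K * L ^ 2 * (d x + L ^ 2))
    (D : ℝ) (hD : 0 ≤ D) (v : V → ℝ) (hv : ∀ x, v x ≠ 0 → d x ≤ D) :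
    2 * |∑ y, ∑ x, ind (Par y x) * v y * v x| ≤ (√D + 9 * K * L) * ∑ x, v x ^ 2 := by
  classical
  set lam : ℝ := √D + 8 * K * L with hlam
  have hs := Real.sqrt_nonneg D
  have hsq : √D ^ 2 = D := Real.sq_sqrt hD
  have hKL : 0 < K * L := by positivity
  have hKL' : L ≤ K * L := by nlinarith
  have hlamL : 8 * K * L ≤ lam := by linarith
  have hlp : 0 < lam := by linarith
  have hd0 : ∀ x, 0 ≤ d x := fun x => by
    rw [← hd]; exact Finset.sum_nonneg fun _ _ => ind_nonneg _
  set r : ℝ := L / lam with hr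
  have hr0 : 0 < r := by positivity
  have hLr : L = r * lam := by rw [hr]; field_simp
  have hKr : 8 * (K * r) ≤ 1 := by
    rw [hr, ← mul_div_assoc, ← mul_div_assoc, div_le_one hlp]; linarith
  have hr8 : r ≤ 1 / 8 := by nlinarith
  have hlamD : D + 64 * K ^ 2 * L ^ 2 ≤ lam ^ 2 := by
    rw [hlam]; nlinarith [mul_nonneg hs hKL.le]
  set g : V → ℝ := fun y => (1 / lam) * (1 + 4 * d y / lam ^ 2) with hg
  have hgp : ∀ y, 0 < g y := fun y => by
    have := hd0 y
    simp only [hg]; positivity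
  -- bound on the children sum
  have hchild : ∀ x, ∑ y, ind (Par y x) * g y ≤
      d x / lam + 4 * (K * L ^ 2 * (d x + L ^ 2)) / lam ^ 3 := by
    intro x
    have : ∑ y, ind (Par y x) * g y =
        (∑ y, ind (Par y x)) / lam + 4 * (∑ y, ind (Par y x) * d y) / lam ^ 3 := by
      rw [Finset.sum_div, Finset.mul_sum, Finset.sum_div, ← Finset.sum_add_distrib]
      refine Finset.sum_congr rfl fun y _ => ?_
      simp only [hg]; field_simp
    rw [this, hd]
    have := h2 x
    gcongr
  have hterm : ∀ y x, 2 * |ind (Par y x) * v y * v x| ≤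
      ind (Par y x) * ind (v x ≠ 0) * (v y ^ 2 / g y) + ind (Par y x) * g y * v x ^ 2 := by
    intro y x
    by_cases hP : Par y x
    · rw [ind_true hP]
      by_cases hx : v x = 0
      · simp [hx, ind]
      · rw [ind_true hx]
        simp only [one_mul]
        have := hgp y
        rw [div_add' _ _ _ this.ne', le_div_iff₀ this, abs_mul]
        have e0 := sq_nonneg (|v y| - g y * |v x|)
        have e1 : (|v y| - g y * |v x|) ^ 2
            = |v y| ^ 2 - 2 * (|v y| * |v x|) * g y + g y * |v x| ^ 2 * g y := by ring
        rw [e1, sq_abs, sq_abs] at e0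
        linarith
    · simp [ind_false hP]
  have hbr : ∀ x, v x ≠ 0 → (∑ z, ind (Par x z) * ind (v z ≠ 0)) / g x
      + ∑ y, ind (Par y x) * g y ≤ lam + K * L := by
    intro x hx
    have hdx := hv x hx
    have hd0x := hd0 x
    have hc := hchild x
    have hle1 : ∑ z, ind (Par x z) * ind (v z ≠ 0) ≤ 1 := by
      refine le_trans (Finset.sum_le_sum fun z _ => ?_) (uniq_sum_le Par hp x)
      have := ind_nonneg (Par x z)
      have := ind_le_one (v z ≠ 0)
      nlinarith
    set a : ℝ := d x / lam ^ 2 with ha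
    have hda : d x = a * lam ^ 2 := by rw [ha]; field_simp
    have ha0 : 0 ≤ a := by rw [ha]; positivity
    have ec : d x / lam + 4 * (K * L ^ 2 * (d x + L ^ 2)) / lam ^ 3
        = lam * (a + 4 * K * r ^ 2 * a + 4 * K * r ^ 4) := by
      rw [hda, hLr]; field_simp; ring
    rw [ec] at hc
    have hKr' : K * r ≤ 1 / 8 := by linarith
    have hk2 : 4 * K * r ^ 2 ≤ 1 / 16 := by
      calc 4 * K * r ^ 2 = 4 * (K * r) * r := by ring
        _ ≤ 4 * (1 / 8) * (1 / 8) := by gcongr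
        _ = 1 / 16 := by norm_num
    have hk4 : 4 * K * r ^ 4 ≤ r / 2 := by
      have : r ^ 2 ≤ 1 / 8 := by nlinarith
      have : r ^ 3 ≤ 1 / 8 * r := by nlinarith
      calc 4 * K * r ^ 4 = 4 * (K * r) * r ^ 3 := by ring
        _ ≤ 4 * (1 / 8) * (1 / 8 * r) := by
            have : K * r ≤ 1 / 8 := by linarith
            gcongr
        _ ≤ r / 2 := by linarith
    by_cases hcase : a ≤ 1 / 4
    · have hgx : (∑ z, ind (Par x z) * ind (v z ≠ 0)) / g x ≤ lam * (1 - 2 * a) := by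
        rw [div_le_iff₀ (hgp x)]
        refine hle1.trans ?_
        have : lam * (1 - 2 * a) * g x = (1 - 2 * a) * (1 + 4 * a) := by
          simp only [hg]; rw [hda]; field_simp
        rw [this]; nlinarith
      have hf : lam * (1 - 2 * a) + lam * (a + 4 * K * r ^ 2 * a + 4 * K * r ^ 4) ≤
          lam + L := by
        rw [hLr]
        have e5 := mul_le_mul_of_nonneg_right hk2 ha0
        have : (1 - 2 * a) + (a + 4 * K * r ^ 2 * a + 4 * K * r ^ 4) ≤ 1 + r := by linarith
        have e6 := mul_le_mul_of_nonneg_left this hlp.le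
        linarith
      linarith
    · push Not at hcase
      have hz : ∑ z, ind (Par x z) * ind (v z ≠ 0) = 0 := by
        refine Finset.sum_eq_zero fun z _ => ?_
        by_cases hP : Par x z
        · by_cases hvz : v z ≠ 0
          · exfalso
            have e1 := h1 x z hP
            have e2 := hv z hvz
            have : lam ^ 2 / 4 < d x := by rw [hda]; nlinarith [pow_pos hlp 2]
            have hKK : K * L ^ 2 ≤ K ^ 2 * L ^ 2 := by
              have := pow_pos hL 2
              nlinarith
            have : 0 < K * L ^ 2 := by positivity
            linarith
          · rw [ind_false hvz, mul_zero]
        · rw [ind_false hP, zero_mul]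
      rw [hz, zero_div, zero_add]
      refine hc.trans ?_
      have ha1 : a ≤ 1 := by
        rw [ha, div_le_one (by positivity)]
        have : 0 ≤ 64 * K ^ 2 * L ^ 2 := by positivity
        linarith
      have hk2' : 4 * K * r ^ 2 ≤ r / 2 := by
        calc 4 * K * r ^ 2 = 4 * (K * r) * r := by ring
          _ ≤ 4 * (1 / 8) * r := by gcongr
          _ = r / 2 := by ring
      have e5 : 4 * K * r ^ 2 * a ≤ r / 2 * 1 :=
        mul_le_mul hk2' ha1 ha0 (by positivity)
      have : a + 4 * K * r ^ 2 * a + 4 * K * r ^ 4 ≤ 1 + r := by linarith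
      have e3 : lam * (a + 4 * K * r ^ 2 * a + 4 * K * r ^ 4) ≤ lam * (1 + r) :=
        mul_le_mul_of_nonneg_left this hlp.le
      have e4 : lam * (1 + r) = lam + L := by rw [hLr]; ring
      linarith
  calc 2 * |∑ y, ∑ x, ind (Par y x) * v y * v x|
      ≤ 2 * ∑ y, ∑ x, |ind (Par y x) * v y * v x| := by
        gcongr
        refine (Finset.abs_sum_le_sum_abs _ _).trans (Finset.sum_le_sum fun y _ => ?_)
        exact Finset.abs_sum_le_sum_abs _ _
    _ = ∑ y, ∑ x, 2 * |ind (Par y x) * v y * v x| := by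
        simp_rw [Finset.mul_sum]
    _ ≤ ∑ y, ∑ x, (ind (Par y x) * ind (v x ≠ 0) * (v y ^ 2 / g y)
          + ind (Par y x) * g y * v x ^ 2) :=
        Finset.sum_le_sum fun y _ => Finset.sum_le_sum fun x _ => hterm y x
    _ = ∑ x, v x ^ 2 * ((∑ z, ind (Par x z) * ind (v z ≠ 0)) / g x
          + ∑ y, ind (Par y x) * g y) := by
        simp_rw [Finset.sum_add_distrib, mul_add, Finset.sum_add_distrib]
        congr 1
        · refine Finset.sum_congr rfl fun y _ => ?_
          rw [Finset.sum_div, Finset.mul_sum]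
          refine Finset.sum_congr rfl fun x _ => ?_
          ring
        · rw [Finset.sum_comm]
          refine Finset.sum_congr rfl fun y _ => ?_
          rw [Finset.mul_sum]
          refine Finset.sum_congr rfl fun x _ => ?_
          ring
    _ ≤ ∑ x, v x ^ 2 * (lam + K * L) := by
        refine Finset.sum_le_sum fun x _ => ?_
        by_cases hx : v x = 0
        · simp [hx]
        · exact mul_le_mul_of_nonneg_left (hbr x hx) (sq_nonneg _)
    _ = (√D + 9 * K * L) * ∑ x, v x ^ 2 := by
        rw [← Finset.sum_mul, hlam]; ring

end GRG
namespace GRG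

/-- Degree towards small children. -/
noncomputable def dpr {V : Type*} [Fintype V] (Par : V → V → Prop) (d : V → ℝ) (s : ℝ) (x : V) : ℝ :=
  ∑ y, ind (Par y x ∧ ¬ s ≤ d y)

noncomputable def Ssum {V : Type*} [Fintype V] (Par : V → V → Prop) (d : V → ℝ) (s : ℝ)
    (a : V → ℝ) (x : V) : ℝ :=
  ∑ y, ind (Par y x ∧ s ≤ d y) * a y

noncomputable def cco {V : Type*} [Fintype V] (Par : V → V → Prop) (d : V → ℝ) (s σ : ℝ)
    (a : V → ℝ) (x : V) : ℝ :=
  σ * a x / √(dpr Par d s x) - Ssum Par d s a x / dpr Par d s x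

/-- Corrected star test vectors. -/
noncomputable def psi {V : Type*} [Fintype V] (Par : V → V → Prop) (d : V → ℝ) (s σ : ℝ)
    (a : V → ℝ) (y : V) : ℝ :=
  ind (s ≤ d y) * a y + ind (¬ s ≤ d y) * ∑ x, ind (Par y x ∧ s ≤ d x) * cco Par d s σ a x

noncomputable def psiL {V : Type*} [Fintype V] (Par : V → V → Prop) (d : V → ℝ) (s σ : ℝ) :
    (V → ℝ) →ₗ[ℝ] (V → ℝ) where
  toFun := psi Par d s σ
  map_add' a b := by
    funext y
    have hS : ∀ x, Ssum Par d s (a + b) x = Ssum Par d s a x + Ssum Par d s b x := by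
      intro x; simp [Ssum, mul_add, Finset.sum_add_distrib]
    have hc : ∀ x, cco Par d s σ (a + b) x = cco Par d s σ a x + cco Par d s σ b x := by
      intro x; simp only [cco, hS, Pi.add_apply]; ring
    simp only [psi, hc, Pi.add_apply, mul_add, Finset.sum_add_distrib]; ring
  map_smul' k a := by
    funext y
    have hS : ∀ x, Ssum Par d s (k • a) x = k * Ssum Par d s a x := by
      intro x
      simp only [Ssum, Finset.mul_sum, Pi.smul_apply, smul_eq_mul]
      exact Finset.sum_congr rfl fun y _ => by ring
    have hc : ∀ x, cco Par d s σ (k • a) x = k * cco Par d s σ a x := by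
      intro x; simp only [cco, hS, Pi.smul_apply, smul_eq_mul]; ring
    have : ∀ x, ind (Par y x ∧ s ≤ d x) * (k * cco Par d s σ a x)
      = k * (ind (Par y x ∧ s ≤ d x) * cco Par d s σ a x) := fun x => by ring
    simp only [psi, hc, Pi.smul_apply, smul_eq_mul, RingHom.id_apply, this, ← Finset.mul_sum]
    ring

lemma psi_norm_ge {V : Type*} [Fintype V] (Par : V → V → Prop) (d : V → ℝ) (s σ : ℝ)
    (a : V → ℝ) : ∑ x, ind (s ≤ d x) * a x ^ 2 ≤ ∑ y, psi Par d s σ a y ^ 2 := by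
  refine Finset.sum_le_sum fun y _ => ?_
  by_cases h : s ≤ d y
  · simp [psi, ind, h]
  · rw [ind_false h]; nlinarith [sq_nonneg (psi Par d s σ a y)]

/-- Per-vertex inequality. -/
lemma star_ineq (s d' a σ S h τ q : ℝ) (hs : 0 < s) (hσ : σ ^ 2 = 1)
    (hd' : 0 < d') (hS : S ^ 2 ≤ h * τ) (hτ : 0 ≤ τ) (hq : 2 * h ≤ q * d')
    (hcase : (S = 0 ∧ s ≤ d') ∨ (9 / 4 * s ≤ d')) :
    √s * (a ^ 2 + d' * (σ * a / √d' - S / d') ^ 2 - q * τ) ≤ 2 * (√d' * a ^ 2) := by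
  have hsd : 0 < √d' := Real.sqrt_pos.2 hd'
  have hss : 0 < √s := Real.sqrt_pos.2 hs
  have hsq : √d' ^ 2 = d' := Real.sq_sqrt hd'.le
  have e1 : d' * (σ * a / √d' - S / d') ^ 2 = (σ * a - S / √d') ^ 2 := by
    have : S / d' = S / √d' / √d' := by
      rw [div_div, ← sq, hsq]
    rw [this, ← sub_div, div_pow, hsq]; field_simp
  rw [e1]
  have e2 : (S / √d') ^ 2 = S ^ 2 / d' := by rw [div_pow, hsq]
  have hqτ : 2 * (S / √d') ^ 2 ≤ q * τ := by
    rw [e2, ← mul_div_assoc, div_le_iff₀ hd']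
    nlinarith [mul_le_mul_of_nonneg_right hq hτ]
  have hσa : (σ * a) ^ 2 = a ^ 2 := by rw [mul_pow, hσ, one_mul]
  rcases hcase with ⟨hS0, hle⟩ | hle
  · subst hS0
    simp only [zero_div, sub_zero, hσa]
    have : √s ≤ √d' := Real.sqrt_le_sqrt hle
    have e3 : 0 ≤ q * τ := by
      refine le_trans ?_ hqτ; positivity
    have e4 := mul_le_mul_of_nonneg_right this (sq_nonneg a)
    have e5 := mul_nonneg hss.le e3
    nlinarith
  · have h32 : 3 / 2 * √s ≤ √d' := by
      have : √(9 / 4 * s) = 3 / 2 * √s := by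
        rw [Real.sqrt_mul (by norm_num)]
        congr 1
        rw [show (9 / 4 : ℝ) = (3 / 2) ^ 2 by norm_num]
        exact Real.sqrt_sq (by norm_num)
      rw [← this]; exact Real.sqrt_le_sqrt hle
    have e3 : (σ * a - S / √d') ^ 2 ≤ 2 * a ^ 2 + 2 * (S / √d') ^ 2 := by
      nlinarith [sq_nonneg (σ * a + S / √d')]
    have e4 : a ^ 2 + (σ * a - S / √d') ^ 2 - q * τ ≤ 3 * a ^ 2 := by linarith
    have e5 := mul_le_mul_of_nonneg_left e4 hss.le
    have e6 := mul_le_mul_of_nonneg_right h32 (sq_nonneg a)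
    nlinarith

lemma forest_lower {V : Type*} [Fintype V] (Par : V → V → Prop) (d : V → ℝ)
    (hp : ∀ y x x', Par y x → Par y x' → x = x')
    (hd : ∀ x, ∑ y, ind (Par y x) = d x)
    (L K : ℝ) (hL : 0 < L) (hK : 1 ≤ K)
    (h1 : ∀ y x, Par y x → d y ≤ d x / 4 + K * L ^ 2)
    (h2 : ∀ x, ∑ y, ind (Par y x) * d y ≤ K * L ^ 2 * (d x + L ^ 2))
    (s σ : ℝ) (hs : 36 * K ^ 2 * L ^ 2 ≤ s) (hσ : σ ^ 2 = 1) (a : V → ℝ) :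
    (√s - L) * ∑ x, psi Par d s σ a x ^ 2 ≤
      2 * (σ * ∑ y, ∑ x, ind (Par y x) * psi Par d s σ a y * psi Par d s σ a x) := by
  classical
  have hL2 : 0 < L ^ 2 := by positivity
  have hKK : K ≤ K ^ 2 := by nlinarith
  have hKL2 : K * L ^ 2 ≤ K ^ 2 * L ^ 2 := mul_le_mul_of_nonneg_right hKK hL2.le
  have hLK : L ^ 2 ≤ K * L ^ 2 := by nlinarith
  have hs36 : 36 * (K * L ^ 2) ≤ s := by linarith
  have hs0 : 0 < s := by linarith
  have hss : 0 < √s := Real.sqrt_pos.2 hs0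
  have hsqs : √s ^ 2 = s := Real.sq_sqrt hs0.le
  have hsK : 6 * K * L ≤ √s := by
    apply Real.le_sqrt_of_sq_le; nlinarith
  have hd0 : ∀ x, 0 ≤ d x := fun x => by
    rw [← hd]; exact Finset.sum_nonneg fun _ _ => ind_nonneg _
  set ψ := psi Par d s σ a with hψ
  set c := cco Par d s σ a with hc
  set d' := dpr Par d s with hd'
  set S := Ssum Par d s a with hS
  set h : V → ℝ := fun x => ∑ y, ind (Par y x ∧ s ≤ d y) with hh
  set τ : V → ℝ := fun x => ∑ y, ind (Par y x ∧ s ≤ d y) * a y ^ 2 with hτ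
  have ψX : ∀ y, s ≤ d y → ψ y = a y := by
    intro y hy; simp [hψ, psi, ind, hy]
  have ψN : ∀ y, ¬ s ≤ d y → ψ y = ∑ x, ind (Par y x ∧ s ≤ d x) * c x := by
    intro y hy; simp [hψ, psi, ind, hy, hc]
  have hp' : ∀ y x x', (Par y x ∧ s ≤ d x) → (Par y x' ∧ s ≤ d x') → x = x' :=
    fun y x x' h h' => hp y x x' h.1 h'.1
  have hdsplit : ∀ x, d x = h x + d' x := by
    intro x
    rw [← hd, hh, hd', dpr, ← Finset.sum_add_distrib]
    refine Finset.sum_congr rfl fun y _ => ?_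
    by_cases hP : Par y x <;> by_cases hy : s ≤ d y <;> simp [ind, hP, hy]
  have hh0 : ∀ x, 0 ≤ h x := fun x => Finset.sum_nonneg fun _ _ => ind_nonneg _
  have hτ0 : ∀ x, 0 ≤ τ x := fun x =>
    Finset.sum_nonneg fun _ _ => mul_nonneg (ind_nonneg _) (sq_nonneg _)
  have hhb : ∀ x, s ≤ d x → s * h x ≤ 2 * (K * L ^ 2) * d x := by
    intro x hx
    have : s * h x ≤ ∑ y, ind (Par y x) * d y := by
      rw [hh, Finset.mul_sum]
      refine Finset.sum_le_sum fun y _ => ?_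
      by_cases hP : Par y x
      · by_cases hy : s ≤ d y
        · simp [ind, hP, hy]
        · simp [ind, hP, hy, hd0]
      · simp [ind, hP]
    have h3 := h2 x
    have : L ^ 2 ≤ d x := by linarith
    have : K * L ^ 2 * (d x + L ^ 2) ≤ K * L ^ 2 * (d x + d x) := by gcongr
    linarith
  have hS2 : ∀ x, S x ^ 2 ≤ h x * τ x := by
    intro x
    have := Finset.sum_mul_sq_le_sq_mul_sq Finset.univ
      (fun y => ind (Par y x ∧ s ≤ d y)) (fun y => ind (Par y x ∧ s ≤ d y) * a y)
    have hi : ∀ P : Prop, ind P * ind P = ind P := fun P => by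
      by_cases hP : P <;> simp [ind, hP]
    have e1 : ∀ y, ind (Par y x ∧ s ≤ d y) * (ind (Par y x ∧ s ≤ d y) * a y)
        = ind (Par y x ∧ s ≤ d y) * a y := fun y => by rw [← mul_assoc, hi]
    have e2 : ∀ y, (ind (Par y x ∧ s ≤ d y) * a y) ^ 2
        = ind (Par y x ∧ s ≤ d y) * a y ^ 2 := fun y => by rw [mul_pow, sq (ind _), hi]
    have e3 : ∀ y, ind (Par y x ∧ s ≤ d y) ^ 2 = ind (Par y x ∧ s ≤ d y) := fun y => by
      rw [sq (ind _), hi]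
    simp only [e1, e2, e3] at this
    exact this
  have hd'4 : ∀ x, s ≤ d x → 3 / 4 * d x ≤ d' x := by
    intro x hx
    have e1 := hhb x hx
    have e2 := hdsplit x
    have : s * h x ≤ s * (1 / 4 * d x) := by nlinarith [hd0 x]
    have := le_of_mul_le_mul_left this hs0
    linarith
  have hd'p : ∀ x, s ≤ d x → 0 < d' x := fun x hx => by
    have := hd'4 x hx; linarith
  set q : ℝ := 6 * (K * L ^ 2) / s with hq
  have hper : ∀ x, s ≤ d x →
      √s * (a x ^ 2 + d' x * c x ^ 2 - q * τ x) ≤ 2 * (√(d' x) * a x ^ 2) := by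
    intro x hx
    have e4 := hd'4 x hx
    refine star_ineq s (d' x) (a x) σ (S x) (h x) (τ x) q hs0 hσ (hd'p x hx) (hS2 x) (hτ0 x) ?_ ?_
    · rw [hq, div_mul_eq_mul_div, le_div_iff₀ hs0]
      have e1 := hhb x hx
      have : 0 < K * L ^ 2 := by positivity
      nlinarith
    · by_cases hex : ∃ y, Par y x ∧ s ≤ d y
      · right
        obtain ⟨y, hy, hy'⟩ := hex
        have := h1 y x hy
        linarith
      · left
        push Not at hex
        constructor
        · rw [hS, Ssum]
          refine Finset.sum_eq_zero fun y _ => ?_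
          rw [ind_false (fun hy => absurd hy.2 (not_le.2 (hex y hy.1))), zero_mul]
        · have : h x = 0 := by
            rw [hh]
            refine Finset.sum_eq_zero fun y _ => ?_
            rw [ind_false (fun hy => absurd hy.2 (not_le.2 (hex y hy.1)))]
          have := hdsplit x
          linarith
  -- the form
  have hTX : ∀ x, s ≤ d x → ∑ y, ind (Par y x) * ψ y = σ * √(d' x) * a x := by
    intro x hx
    have : ∑ y, ind (Par y x) * ψ y = S x + d' x * c x := by
      rw [hS, Ssum, hd', dpr, Finset.sum_mul, ← Finset.sum_add_distrib]
      refine Finset.sum_congr rfl fun y _ => ?_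
      by_cases hP : Par y x
      · by_cases hy : s ≤ d y
        · rw [ψX y hy]; simp [ind, hP, hy]
        · rw [ψN y hy, uniq_sum (fun y x => Par y x ∧ s ≤ d x) hp' c y x ⟨hP, hx⟩]
          simp [ind, hP, hy]
      · simp [ind, hP]
    rw [this, hc, cco]
    have hp0 := hd'p x hx
    have hsd : 0 < √(d' x) := Real.sqrt_pos.2 hp0
    have hsq : √(d' x) * √(d' x) = d' x := Real.mul_self_sqrt hp0.le
    have : d' x * (σ * a x / √(d' x) - S x / d' x) = σ * √(d' x) * a x - S x := by
      rw [mul_sub, mul_div_cancel₀ _ hp0.ne']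
      congr 1
      nth_rw 1 [← hsq]
      field_simp
    rw [this]; ring
  have hTN : ∀ x, ¬ s ≤ d x → ∑ y, ind (Par y x) * ψ y = 0 := by
    intro x hx
    refine Finset.sum_eq_zero fun y _ => ?_
    by_cases hP : Par y x
    · by_cases hy : s ≤ d y
      · exfalso
        have := h1 y x hP
        push Not at hx
        linarith
      · rw [ψN y hy, Finset.sum_eq_zero, mul_zero]
        intro x' _
        rw [ind_false, zero_mul]
        rintro ⟨hP', hx'⟩
        rw [hp y x x' hP hP'] at hx
        exact hx hx'
    · simp [ind, hP]
  have hF : ∑ y, ∑ x, ind (Par y x) * ψ y * ψ x = ∑ x, ind (s ≤ d x) * (σ * √(d' x) * a x ^ 2) := by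
    rw [Finset.sum_comm]
    refine Finset.sum_congr rfl fun x _ => ?_
    rw [← Finset.sum_mul]
    by_cases hx : s ≤ d x
    · rw [hTX x hx, ψX x hx, ind_true hx]; ring
    · rw [hTN x hx, ind_false hx]; ring
  have hN : ∑ x, ψ x ^ 2 ≤ ∑ x, ind (s ≤ d x) * (a x ^ 2 + d' x * c x ^ 2) := by
    have e1 : ∀ y, ψ y ^ 2 ≤ ind (s ≤ d y) * a y ^ 2 +
        ∑ x, ind (s ≤ d x) * (ind (Par y x ∧ ¬ s ≤ d y) * c x ^ 2) := by
      intro y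
      have hnn : 0 ≤ ∑ x, ind (s ≤ d x) * (ind (Par y x ∧ ¬ s ≤ d y) * c x ^ 2) :=
        Finset.sum_nonneg fun _ _ =>
          mul_nonneg (ind_nonneg _) (mul_nonneg (ind_nonneg _) (sq_nonneg _))
      by_cases hy : s ≤ d y
      · rw [ψX y hy, ind_true hy]; linarith
      · rw [ψN y hy, ind_false hy, zero_mul, zero_add]
        by_cases hex : ∃ x, Par y x ∧ s ≤ d x
        · obtain ⟨x, hx⟩ := hex
          rw [uniq_sum (fun y x => Par y x ∧ s ≤ d x) hp' c y x hx]
          have e5 := Finset.single_le_sum (f := fun x =>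
            ind (s ≤ d x) * (ind (Par y x ∧ ¬ s ≤ d y) * c x ^ 2))
            (fun i _ => mul_nonneg (ind_nonneg _) (mul_nonneg (ind_nonneg _) (sq_nonneg _)))
            (Finset.mem_univ x)
          refine le_trans (le_of_eq ?_) e5
          simp [ind, hx.1, hx.2, hy]
        · push Not at hex
          rw [Finset.sum_eq_zero (fun x _ => by
            rw [ind_false (fun hh => absurd hh.2 (not_le.2 (hex x hh.1))), zero_mul])]
          simpa using hnn
    refine (Finset.sum_le_sum fun y _ => e1 y).trans ?_
    rw [Finset.sum_add_distrib, Finset.sum_comm, ← Finset.sum_add_distrib]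
    refine le_of_eq (Finset.sum_congr rfl fun x _ => ?_)
    rw [← Finset.mul_sum, ← Finset.sum_mul, hd', dpr]; ring
  have hτs : ∑ x, ind (s ≤ d x) * τ x ≤ ∑ x, ψ x ^ 2 := by
    refine le_trans ?_ (psi_norm_ge Par d s σ a)
    calc ∑ x, ind (s ≤ d x) * τ x ≤ ∑ x, τ x := by
          refine Finset.sum_le_sum fun x _ => ?_
          have := ind_le_one (s ≤ d x)
          have := hτ0 x
          nlinarith
      _ = ∑ y, ∑ x, ind (Par y x) * (ind (s ≤ d y) * a y ^ 2) := by
          rw [hτ, Finset.sum_comm]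
          refine Finset.sum_congr rfl fun y _ => Finset.sum_congr rfl fun x _ => ?_
          by_cases hP : Par y x <;> by_cases hy : s ≤ d y <;> simp [ind, hP, hy]
      _ ≤ _ := by
          refine Finset.sum_le_sum fun y _ => ?_
          rw [← Finset.sum_mul]
          have e1 := uniq_sum_le Par hp y
          have e2 : 0 ≤ ind (s ≤ d y) * a y ^ 2 := mul_nonneg (ind_nonneg _) (sq_nonneg _)
          nlinarith
  have hsum : √s * (∑ x, ind (s ≤ d x) * (a x ^ 2 + d' x * c x ^ 2)
      - q * ∑ x, ind (s ≤ d x) * τ x) ≤ 2 * ∑ x, ind (s ≤ d x) * (√(d' x) * a x ^ 2) := by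
    rw [Finset.mul_sum, ← Finset.sum_sub_distrib, Finset.mul_sum, Finset.mul_sum]
    refine Finset.sum_le_sum fun x _ => ?_
    by_cases hx : s ≤ d x
    · rw [ind_true hx]; simp only [one_mul]; exact hper x hx
    · rw [ind_false hx]; simp
  have hσF : σ * ∑ x, ind (s ≤ d x) * (σ * √(d' x) * a x ^ 2)
      = ∑ x, ind (s ≤ d x) * (√(d' x) * a x ^ 2) := by
    rw [Finset.mul_sum]
    refine Finset.sum_congr rfl fun x _ => ?_
    calc _ = σ ^ 2 * (ind (s ≤ d x) * (√(d' x) * a x ^ 2)) := by ring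
      _ = _ := by rw [hσ, one_mul]
  rw [hF, hσF]
  refine le_trans ?_ hsum
  have hq0 : 0 ≤ q := by rw [hq]; positivity
  have hsq : √s * q ≤ L := by
    rw [hq, ← mul_div_assoc, div_le_iff₀ hs0]
    have e1 : 6 * (K * L ^ 2) ≤ L * √s := by nlinarith
    calc √s * (6 * (K * L ^ 2)) ≤ √s * (L * √s) := mul_le_mul_of_nonneg_left e1 hss.le
      _ = L * (√s ^ 2) := by ring
      _ = L * s := by rw [hsqs]
  have hΨ0 : 0 ≤ ∑ x, ψ x ^ 2 := Finset.sum_nonneg fun _ _ => sq_nonneg _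
  have e1 := mul_le_mul_of_nonneg_left hN hss.le
  have e2 : √s * q * ∑ x, ind (s ≤ d x) * τ x ≤ √s * q * ∑ x, ψ x ^ 2 :=
    mul_le_mul_of_nonneg_left hτs (by positivity)
  have e3 := mul_le_mul_of_nonneg_right hsq hΨ0
  nlinarith

end GRG
namespace GRG

lemma exists_ker {N : ℕ} (i : Fin N) (k : Fin N → ((Fin N → ℝ) →ₗ[ℝ] ℝ)) :
    ∃ v : Fin N → ℝ, v ≠ 0 ∧ ∀ j, j ≠ i → k j v = 0 := by
  classical
  have h := LinearMap.ker_ne_bot_of_finrank_lt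
    (f := LinearMap.pi (fun j : {j : Fin N // j ≠ i} => k j.1)) (by
      rw [Module.finrank_fin_fun, Module.finrank_fintype_fun_eq_card]
      have : Fintype.card {j : Fin N // j ≠ i} < Fintype.card (Fin N) :=
        Fintype.card_subtype_lt (x := i) (by simp)
      simpa using this)
  obtain ⟨v, hv, hv0⟩ := (Submodule.ne_bot_iff _).1 h
  refine ⟨v, hv0, fun j hj => ?_⟩
  have := congrFun (LinearMap.mem_ker.1 hv) ⟨j, hj⟩
  simpa using this

/-- The linear functional `v ↦ u · v`. -/
noncomputable def dotL {N : ℕ} (u : Fin N → ℝ) : (Fin N → ℝ) →ₗ[ℝ] ℝ where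
  toFun v := ∑ x, u x * v x
  map_add' a b := by simp [mul_add, Finset.sum_add_distrib]
  map_smul' k a := by
    simp only [Pi.smul_apply, smul_eq_mul, RingHom.id_apply, Finset.mul_sum]
    exact Finset.sum_congr rfl fun y _ => by ring

lemma sumsq_pos {N : ℕ} (v : Fin N → ℝ) (hv : v ≠ 0) : 0 < ∑ x, v x ^ 2 := by
  obtain ⟨x, hx⟩ := Function.ne_iff.1 hv
  have hx' : v x ≠ 0 := hx
  exact Finset.sum_pos' (fun _ _ => sq_nonneg _) ⟨x, Finset.mem_univ _, by positivity⟩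

lemma assembly {N : ℕ} (Par Rem : Fin N → Fin N → Prop) (d D : Fin N → ℝ)
    (hp : ∀ y x x', Par y x → Par y x' → x = x')
    (hd : ∀ x, ∑ y, ind (Par y x) = d x)
    (L K : ℝ) (hL : 0 < L) (hK : 1 ≤ K)
    (h1 : ∀ y x, Par y x → d y ≤ d x / 4 + K * L ^ 2)
    (h2 : ∀ x, ∑ y, ind (Par y x) * d y ≤ K * L ^ 2 * (d x + L ^ 2))
    (hdD : ∀ x, d x ≤ D x) (hDd : ∀ x, D x ≤ d x + K * L ^ 2)
    (hRem : ∀ v : Fin N → ℝ,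
      |∑ y, ∑ x, ind (Rem y x) * v y * v x| ≤ K * L * ∑ x, v x ^ 2)
    (σ : ℝ) (hσ : σ ^ 2 = 1) (e : Fin N → ℝ) (he : Antitone e) (u : Fin N → Fin N → ℝ)
    (hPars : ∀ v : Fin N → ℝ, ∑ j, (∑ x, u j x * v x) ^ 2 = ∑ x, v x ^ 2)
    (hq : ∀ v : Fin N → ℝ, ∑ j, e j * (∑ x, u j x * v x) ^ 2 =
      2 * (σ * (∑ y, ∑ x, ind (Par y x) * v y * v x)) +
      2 * (σ * (∑ y, ∑ x, ind (Rem y x) * v y * v x)))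
    (perm : Equiv.Perm (Fin N)) (hperm : ∀ i j : Fin N, i ≤ j → D (perm j) ≤ D (perm i))
    (i : Fin N) (hi : 50 * K * L < e i) :
    |e i - √(D (perm i))| ≤ 50 * K * L := by
  have hd0 : ∀ x, 0 ≤ d x := fun x => by
    rw [← hd]; exact Finset.sum_nonneg fun _ _ => ind_nonneg _
  have hKL : 0 < K * L := by positivity
  have hKL' : L ≤ K * L := by nlinarith
  set D0 := D (perm i) with hD0
  have hD00 : 0 ≤ D0 := (hd0 _).trans (hdD _)
  have hs0 := Real.sqrt_nonneg D0
  have hsq : √D0 ^ 2 = D0 := Real.sq_sqrt hD00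
  have habs : ∀ t : ℝ, |σ * t| = |t| := fun t => by
    have : |σ| = 1 := by
      have := sq_abs σ; rw [hσ] at this
      nlinarith [abs_nonneg σ]
    rw [abs_mul, this, one_mul]
  -- upper bound
  have hup : e i ≤ √D0 + 11 * (K * L) := by
    obtain ⟨v, hv, hk⟩ := exists_ker i
      (fun j => if j < i then LinearMap.proj (perm j) else dotL (u j))
    have hpos := sumsq_pos v hv
    have hlow : e i * ∑ x, v x ^ 2 ≤ ∑ j, e j * (∑ x, u j x * v x) ^ 2 := by
      rw [← hPars, Finset.mul_sum]
      refine Finset.sum_le_sum fun j _ => ?_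
      rcases lt_trichotomy j i with h | h | h
      · exact mul_le_mul_of_nonneg_right (he h.le) (sq_nonneg _)
      · rw [h]
      · have := hk j h.ne'
        rw [if_neg (not_lt.2 h.le)] at this
        have : ∑ x, u j x * v x = 0 := this
        rw [this]; simp
    rw [hq] at hlow
    have hF := forest_upper Par d hp hd L K hL hK h1 h2 D0 hD00 v (fun x hx => by
      by_contra hcon
      apply hx
      have hlt : perm.symm x < i := by
        by_contra hge
        have := hperm i (perm.symm x) (not_lt.1 hge)
        rw [Equiv.apply_symm_apply] at this
        exact hcon ((hdD x).trans this)
      have := hk _ hlt.ne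
      rw [if_pos hlt] at this
      simpa using this)
    have hR := hRem v
    have b1 := le_abs_self (σ * (∑ y, ∑ x, ind (Par y x) * v y * v x))
    have b2 := le_abs_self (σ * (∑ y, ∑ x, ind (Rem y x) * v y * v x))
    rw [habs] at b1 b2
    have : e i * ∑ x, v x ^ 2 ≤ (√D0 + 11 * (K * L)) * ∑ x, v x ^ 2 := by nlinarith
    exact le_of_mul_le_mul_right this hpos
  have h39 : 39 * (K * L) ≤ √D0 := by linarith
  -- lower bound
  have hlo : √D0 - 4 * (K * L) ≤ e i := by
    set s := D0 - K * L ^ 2 with hs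
    have hKK : K ≤ K ^ 2 := by nlinarith
    have hL2 : 0 < L ^ 2 := by positivity
    have hKLs : K * L ^ 2 ≤ K ^ 2 * L ^ 2 := mul_le_mul_of_nonneg_right hKK hL2.le
    have hDbig : 1521 * (K ^ 2 * L ^ 2) ≤ D0 := by rw [← hsq]; nlinarith
    have hs36 : 36 * K ^ 2 * L ^ 2 ≤ s := by
      have : 0 ≤ K ^ 2 * L ^ 2 := by positivity
      rw [hs]; linarith
    obtain ⟨a, ha, hk⟩ := exists_ker i
      (fun j => if j < i then (dotL (u j)).comp (psiL Par d s σ) else LinearMap.proj (perm j))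
    have hnorm : 0 < ∑ x, psi Par d s σ a x ^ 2 := by
      refine lt_of_lt_of_le ?_ (psi_norm_ge Par d s σ a)
      obtain ⟨x, hx⟩ := Function.ne_iff.1 ha
      have hx' : a x ≠ 0 := hx
      refine Finset.sum_pos' (fun _ _ => mul_nonneg (ind_nonneg _) (sq_nonneg _))
        ⟨x, Finset.mem_univ _, ?_⟩
      have hle : perm.symm x ≤ i := by
        by_contra hgt
        have hgt := not_le.1 hgt
        have := hk _ hgt.ne'
        rw [if_neg (not_lt.2 hgt.le)] at this
        exact hx' (by simpa using this)
      have h3 := hperm _ _ hle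
      rw [Equiv.apply_symm_apply] at h3
      have h4 : s ≤ d x := by
        have := hDd x
        rw [hs]; linarith
      rw [ind_true h4]; positivity
    have hform : ∑ j, e j * (∑ x, u j x * psi Par d s σ a x) ^ 2 ≤
        e i * ∑ x, psi Par d s σ a x ^ 2 := by
      rw [← hPars, Finset.mul_sum]
      refine Finset.sum_le_sum fun j _ => ?_
      rcases lt_or_ge j i with h | h
      · have := hk j h.ne
        rw [if_pos h] at this
        have : ∑ x, u j x * psi Par d s σ a x = 0 := this
        rw [this]; simp
      · exact mul_le_mul_of_nonneg_right (he h) (sq_nonneg _)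
    rw [hq] at hform
    have hF := forest_lower Par d hp hd L K hL hK h1 h2 s σ hs36 hσ a
    have hR := hRem (psi Par d s σ a)
    have b2 := neg_abs_le (σ * (∑ y, ∑ x, ind (Rem y x) * psi Par d s σ a y * psi Par d s σ a x))
    rw [habs] at b2
    have h5 : (√s - L - 2 * (K * L)) * ∑ x, psi Par d s σ a x ^ 2 ≤
        e i * ∑ x, psi Par d s σ a x ^ 2 := by nlinarith
    have h6 := le_of_mul_le_mul_right h5 hnorm
    have h7 : √D0 - K * L ≤ √s := by
      apply Real.le_sqrt_of_sq_le
      rw [hs]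
      have : 39 * (K * L) * (K * L) ≤ √D0 * (K * L) := mul_le_mul_of_nonneg_right h39 hKL.le
      nlinarith
    linarith
  rw [abs_le]; constructor <;> linarith

/-- Spectral decomposition in coordinates. -/
lemma spectral {N : ℕ} (M : Matrix (Fin N) (Fin N) ℝ) (hM : M.IsHermitian) :
    ∃ u : Fin N → Fin N → ℝ,
      (∀ v : Fin N → ℝ, ∑ j, (∑ x, u j x * v x) ^ 2 = ∑ x, v x ^ 2) ∧
      (∀ v : Fin N → ℝ, ∑ j, hM.eigenvalues j * (∑ x, u j x * v x) ^ 2 =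
        ∑ y, ∑ x, M y x * v y * v x) := by
  refine ⟨fun j x => hM.eigenvectorBasis j x, fun v => ?_, fun v => ?_⟩
  · have := hM.eigenvectorBasis.sum_sq_norm_inner_right (WithLp.toLp 2 v)
    simp only [EuclideanSpace.norm_sq_eq, PiLp.inner_apply] at this
    simp only [Real.norm_eq_abs, sq_abs] at this
    rw [← this]
    refine Finset.sum_congr rfl fun j _ => ?_
    congr 1
    refine Finset.sum_congr rfl fun x _ => ?_
    simp [mul_comm]
  · have hv : ∀ y, (M.mulVec v) y = ∑ j, hM.eigenvalues j *
        (∑ x, hM.eigenvectorBasis j x * v x) * hM.eigenvectorBasis j y := by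
      intro y
      have hrep := hM.eigenvectorBasis.sum_repr' (WithLp.toLp 2 v)
      have hvv : v = ∑ j, (∑ x, hM.eigenvectorBasis j x * v x) •
          (fun y => hM.eigenvectorBasis j y) := by
        funext z
        have := congrArg (fun t : EuclideanSpace ℝ (Fin N) => t z) hrep
        simp only [PiLp.inner_apply] at this
        simp only [Finset.sum_apply, Pi.smul_apply, smul_eq_mul]
        have h2 := this.symm
        simp at h2
        rw [h2]
        refine Finset.sum_congr rfl fun j _ => ?_
        congr 1
        refine Finset.sum_congr rfl fun x _ => ?_
        ring
      have key : M.mulVec v = ∑ j, (∑ x, hM.eigenvectorBasis j x * v x) •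
          (hM.eigenvalues j • (fun y => hM.eigenvectorBasis j y)) := by
        conv_lhs => rw [hvv]
        rw [Matrix.mulVec_sum]
        refine Finset.sum_congr rfl fun j _ => ?_
        rw [Matrix.mulVec_smul]
        congr 1
        exact hM.mulVec_eigenvectorBasis j
      rw [key]
      simp only [Finset.sum_apply, Pi.smul_apply, smul_eq_mul]
      refine Finset.sum_congr rfl fun j _ => ?_
      ring
    have e1 : ∑ y, ∑ x, M y x * v y * v x = ∑ y, v y * (M.mulVec v) y := by
      refine Finset.sum_congr rfl fun y _ => ?_
      simp only [Matrix.mulVec, dotProduct, Finset.mul_sum]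
      refine Finset.sum_congr rfl fun x _ => ?_
      ring
    rw [e1]
    simp only [hv, Finset.mul_sum]
    rw [Finset.sum_comm]
    refine Finset.sum_congr rfl fun j _ => ?_
    rw [sq, ← mul_assoc, Finset.mul_sum]
    refine Finset.sum_congr rfl fun y _ => ?_
    simp only [← Finset.mul_sum]
    ring

end GRG
namespace GRG

variable {N : ℕ}

def up (w : Fin N → ℝ) (y x : Fin N) : Prop := w y < w x ∨ (w y = w x ∧ y < x)

def near (w : Fin N → ℝ) (Δ : ℝ) (y x : Fin N) : Prop := w x ≤ Δ ^ 2 ∨ w x ≤ Δ * w y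

def RemE (w : Fin N → ℝ) (Δ : ℝ) (ω : EdgeIdx N → Bool) (y x : Fin N) : Prop :=
  up w y x ∧ Adj ω y x ∧ (near w Δ y x ∨ ∃ z, up w x z ∧ Adj ω y z)

def ParE (w : Fin N → ℝ) (Δ : ℝ) (ω : EdgeIdx N → Bool) (y x : Fin N) : Prop :=
  up w y x ∧ Adj ω y x ∧ ¬ near w Δ y x ∧ ∀ z, up w x z → ¬ Adj ω y z

noncomputable def InR (w : Fin N → ℝ) (Δ : ℝ) (ω : EdgeIdx N → Bool) (x : Fin N) : ℝ :=
  ∑ y, ind (RemE w Δ ω y x)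

noncomputable def dP (w : Fin N → ℝ) (Δ : ℝ) (ω : EdgeIdx N → Bool) (x : Fin N) : ℝ :=
  ∑ y, ind (ParE w Δ ω y x)

noncomputable def Ud (w : Fin N → ℝ) (ω : EdgeIdx N → Bool) (y : Fin N) : ℝ :=
  ∑ x, ind (up w y x ∧ Adj ω y x)

lemma up_irrefl (w : Fin N → ℝ) (x : Fin N) : ¬ up w x x := by simp [up]

lemma up_asymm (w : Fin N → ℝ) {x y : Fin N} (h : up w x y) : ¬ up w y x := by
  unfold up at *
  rintro (h' | ⟨h', h''⟩) <;> rcases h with h | ⟨h, h2⟩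
  · linarith
  · linarith
  · linarith
  · exact absurd h'' (not_lt.2 h2.le)

lemma up_total (w : Fin N → ℝ) {x y : Fin N} (h : x ≠ y) : up w x y ∨ up w y x := by
  unfold up
  rcases lt_trichotomy (w x) (w y) with h1 | h1 | h1
  · exact Or.inl (Or.inl h1)
  · rcases lt_or_gt_of_ne h with h2 | h2
    · exact Or.inl (Or.inr ⟨h1, h2⟩)
    · exact Or.inr (Or.inr ⟨h1.symm, h2⟩)
  · exact Or.inr (Or.inl h1)

lemma up_le (w : Fin N → ℝ) {x y : Fin N} (h : up w x y) : w x ≤ w y := by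
  rcases h with h | h
  · exact h.le
  · exact h.1.le

lemma adj_irrefl (ω : EdgeIdx N → Bool) (x : Fin N) : ¬ Adj ω x x := by
  simp [Adj, adjMatrix]

lemma adjMatrix_symm (ω : EdgeIdx N → Bool) (x y : Fin N) :
    adjMatrix ω x y = adjMatrix ω y x := by
  unfold adjMatrix
  rcases lt_trichotomy x y with h | h | h
  · rw [dif_pos h, dif_neg (not_lt.2 h.le), dif_pos h]
  · subst h; rfl
  · rw [dif_neg (not_lt.2 h.le), dif_pos h, dif_pos h]

lemma adj_symm (ω : EdgeIdx N → Bool) (x y : Fin N) : Adj ω x y ↔ Adj ω y x := by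
  rw [Adj, Adj, adjMatrix_symm]

lemma adjMatrix_eq_ind (ω : EdgeIdx N → Bool) (x y : Fin N) :
    adjMatrix ω x y = ind (Adj ω x y) := by
  unfold ind Adj
  split_ifs with h
  · exact h
  · unfold adjMatrix at *
    split_ifs at * <;> simp_all

lemma deg_eq (ω : EdgeIdx N → Bool) (x : Fin N) : (deg ω x : ℝ) = ∑ y, ind (Adj ω x y) := by
  classical
  unfold deg degA ind
  rw [Finset.sum_boole, Set.ncard_eq_toFinset_card']
  congr 2
  ext y; simp

lemma ParE_uniq (w : Fin N → ℝ) (Δ : ℝ) (ω : EdgeIdx N → Bool) (y x x' : Fin N)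
    (h : ParE w Δ ω y x) (h' : ParE w Δ ω y x') : x = x' := by
  by_contra hne
  rcases up_total w hne with hu | hu
  · exact h.2.2.2 _ hu h'.2.1
  · exact h'.2.2.2 _ hu h.2.1

lemma ind_rem_par (w : Fin N → ℝ) (Δ : ℝ) (ω : EdgeIdx N → Bool) (y x : Fin N) :
    ind (RemE w Δ ω y x) + ind (ParE w Δ ω y x) = ind (up w y x ∧ Adj ω y x) := by
  by_cases h : up w y x ∧ Adj ω y x
  · rw [ind_true h]
    by_cases hr : near w Δ y x ∨ ∃ z, up w x z ∧ Adj ω y z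
    · rw [ind_true (show RemE w Δ ω y x from ⟨h.1, h.2, hr⟩), ind_false]
      · simp
      · rintro ⟨_, _, h3, h4⟩
        rcases hr with hr | ⟨z, hz, hz'⟩
        · exact h3 hr
        · exact h4 z hz hz'
    · push Not at hr
      rw [ind_true (show ParE w Δ ω y x from ⟨h.1, h.2, hr⟩), ind_false]
      · simp
      · rintro ⟨_, _, h3 | ⟨z, hz, hz'⟩⟩
        · exact hr.1 h3
        · exact hr.2 z hz hz'
  · rw [ind_false h, ind_false (fun h' => h ⟨h'.1, h'.2.1⟩),
      ind_false (fun h' => h ⟨h'.1, h'.2.1⟩)]; simp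

lemma ind_adj (w : Fin N → ℝ) (ω : EdgeIdx N → Bool) (y x : Fin N) :
    ind (Adj ω y x) = ind (up w y x ∧ Adj ω y x) + ind (up w x y ∧ Adj ω x y) := by
  by_cases h : Adj ω y x
  · have hne : y ≠ x := by rintro rfl; exact adj_irrefl ω _ h
    rw [ind_true h]
    rcases up_total w hne with hu | hu
    · rw [ind_true ⟨hu, h⟩, ind_false (fun h' => up_asymm w hu h'.1)]; simp
    · rw [ind_false (fun h' => up_asymm w hu h'.1), ind_true ⟨hu, (adj_symm _ _ _).1 h⟩]; simp
  · rw [ind_false h, ind_false (fun h' => h h'.2),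
      ind_false (fun h' => h ((adj_symm _ _ _).1 h'.2))]; simp

lemma deg_split (w : Fin N → ℝ) (Δ : ℝ) (ω : EdgeIdx N → Bool) (x : Fin N) :
    (deg ω x : ℝ) = dP w Δ ω x + InR w Δ ω x + Ud w ω x := by
  rw [deg_eq, dP, InR, Ud]
  simp only [ind_adj w ω x, Finset.sum_add_distrib, ← ind_rem_par w Δ]
  ring

lemma form_split (w : Fin N → ℝ) (Δ : ℝ) (ω : EdgeIdx N → Bool) (v : Fin N → ℝ) :
    ∑ y, ∑ x, adjMatrix ω y x * v y * v x =
      2 * (∑ y, ∑ x, ind (ParE w Δ ω y x) * v y * v x) +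
      2 * (∑ y, ∑ x, ind (RemE w Δ ω y x) * v y * v x) := by
  have e1 : ∑ y, ∑ x, ind (up w x y ∧ Adj ω x y) * v y * v x =
      ∑ y, ∑ x, ind (up w y x ∧ Adj ω y x) * v y * v x := by
    rw [Finset.sum_comm]
    refine Finset.sum_congr rfl fun y _ => Finset.sum_congr rfl fun x _ => ?_
    ring
  simp only [adjMatrix_eq_ind, ind_adj w ω, add_mul, Finset.sum_add_distrib, e1]
  simp only [← ind_rem_par w Δ, add_mul, Finset.sum_add_distrib]
  ring

/-- The good event. -/
structure Good (w : Fin N → ℝ) (Δ L C A θi θo X : ℝ) (ω : EdgeIdx N → Bool) : Prop where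
  E1 : ∀ y, ∑ x, ind (RemE w Δ ω y x ∧ θi ≤ InR w Δ ω x) * InR w Δ ω x ≤ C * L ^ 2
  E2 : ∀ x, ∑ y, ind (RemE w Δ ω y x ∧ θo ≤ Ud w ω y) * Ud w ω y ≤ C * L ^ 2
  E2' : ∀ y, Ud w ω y ≤ C * L ^ 2
  E3 : ∀ y, (deg ω y : ℝ) ≤ A * w y + C * L ^ 2
  E4 : ∀ x, X ≤ w x → w x ≤ 16 * deg ω x
  E5 : ∀ x, Δ * ∑ y, ind (Adj ω y x ∧ Δ * w y ≤ w x) * w y ≤ X * w x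

lemma InR_nonneg (w : Fin N → ℝ) (Δ : ℝ) (ω : EdgeIdx N → Bool) (x : Fin N) :
    0 ≤ InR w Δ ω x := Finset.sum_nonneg fun _ _ => ind_nonneg _
lemma dP_nonneg (w : Fin N → ℝ) (Δ : ℝ) (ω : EdgeIdx N → Bool) (x : Fin N) :
    0 ≤ dP w Δ ω x := Finset.sum_nonneg fun _ _ => ind_nonneg _
lemma Ud_nonneg (w : Fin N → ℝ) (ω : EdgeIdx N → Bool) (x : Fin N) :
    0 ≤ Ud w ω x := Finset.sum_nonneg fun _ _ => ind_nonneg _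

lemma det_main (w : Fin N → ℝ) (hw : ∀ x, 0 < w x) (Δ L C A θi θo X : ℝ)
    (hΔ : 0 < Δ) (hL : 0 < L) (hC : 1 ≤ C) (hA : 0 ≤ A) (hθi : 0 < θi) (hθo : 0 < θo)
    (hX : 0 ≤ X)
    (hθ : θi * θo ≤ L ^ 2) (hθi' : θi ≤ L ^ 2) (hA1 : A * X ≤ Δ * L ^ 2)
    (hA2 : A * X ^ 2 ≤ Δ * L ^ 4) (hA3 : 64 * A ≤ Δ)
    (ω : EdgeIdx N → Bool) (hg : Good w Δ L C A θi θo X ω)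
    (hH : (adjMatrix ω).IsHermitian) (σ : Equiv.Perm (Fin N))
    (hσ : Antitone (hH.eigenvalues ∘ σ)) (perm : Equiv.Perm (Fin N))
    (hperm : ∀ i j : Fin N, i < j → precA (Adj ω) (perm j) (perm i)) (i : Fin N) :
    (50 * (50 * (C + 1)) * L < hH.eigenvalues (σ i) →
      |hH.eigenvalues (σ i) - Real.sqrt (deg ω (perm i))| ≤ 50 * (50 * (C + 1)) * L) ∧
    (hH.eigenvalues (σ i) < -(50 * (50 * (C + 1)) * L) →
      |hH.eigenvalues (σ i) + Real.sqrt (deg ω (perm i.rev))| ≤ 50 * (50 * (C + 1)) * L) := by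
  set K := 50 * (C + 1) with hK
  have hL2 : 0 < L ^ 2 := by positivity
  have hCL : L ^ 2 ≤ C * L ^ 2 := by nlinarith
  have hIn : ∀ x, InR w Δ ω x ≤ C * L ^ 2 := by
    intro x
    by_contra hcon
    push Not at hcon
    have hpos : 0 < InR w Δ ω x := by linarith
    obtain ⟨y, _, hy⟩ : ∃ y ∈ Finset.univ, 0 < ind (RemE w Δ ω y x) :=
      Finset.exists_lt_of_sum_lt (f := fun _ => (0 : ℝ)) (by simpa [InR] using hpos)
    have hy' : RemE w Δ ω y x := by
      by_contra h; rw [ind_false h] at hy; exact lt_irrefl _ hy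
    have h1 := Finset.single_le_sum (f := fun x => ind (RemE w Δ ω y x ∧ θi ≤ InR w Δ ω x)
      * InR w Δ ω x) (fun x _ => mul_nonneg (ind_nonneg _) (InR_nonneg _ _ _ _))
      (Finset.mem_univ x)
    have h2 : θi ≤ InR w Δ ω x := by linarith
    simp only [ind_true (And.intro hy' h2), one_mul] at h1
    linarith [hg.E1 y]
  have hdD : ∀ x, dP w Δ ω x ≤ deg ω x := fun x => by
    rw [deg_split w Δ]; linarith [InR_nonneg w Δ ω x, Ud_nonneg w ω x]
  have hDd : ∀ x, (deg ω x : ℝ) ≤ dP w Δ ω x + 2 * C * L ^ 2 := fun x => by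
    rw [deg_split w Δ]; linarith [hIn x, hg.E2' x]
  have hwx : ∀ x, w x ≤ X + 16 * (dP w Δ ω x + 2 * C * L ^ 2) := by
    intro x
    have h0 := dP_nonneg w Δ ω x
    by_cases h : X ≤ w x
    · have := hg.E4 x h
      have := hDd x
      linarith
    · have : 0 ≤ C * L ^ 2 := by positivity
      linarith
  have h1 : ∀ y x, ParE w Δ ω y x → dP w Δ ω y ≤ dP w Δ ω x / 4 + K * L ^ 2 := by
    intro y x h
    have hn : Δ * w y < w x := by
      have := h.2.2.1
      unfold near at this; push Not at this; exact this.2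
    have hy := (hdD y).trans (hg.E3 y)
    have hx := hwx x
    have h0 := dP_nonneg w Δ ω x
    have h3 : Δ * (A * w y) ≤ Δ * (L ^ 2 + (dP w Δ ω x + 2 * C * L ^ 2) / 4) := by
      calc Δ * (A * w y) = A * (Δ * w y) := by ring
        _ ≤ A * (X + 16 * (dP w Δ ω x + 2 * C * L ^ 2)) :=
            mul_le_mul_of_nonneg_left (by linarith) hA
        _ = A * X + (64 * A) * ((dP w Δ ω x + 2 * C * L ^ 2) / 4) := by ring
        _ ≤ Δ * L ^ 2 + Δ * ((dP w Δ ω x + 2 * C * L ^ 2) / 4) := by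
            have : 0 ≤ (dP w Δ ω x + 2 * C * L ^ 2) / 4 := by positivity
            exact add_le_add hA1 (mul_le_mul_of_nonneg_right hA3 this)
        _ = _ := by ring
    have h4 := le_of_mul_le_mul_left h3 hΔ
    rw [hK]; nlinarith
  have h2 : ∀ x, ∑ y, ind (ParE w Δ ω y x) * dP w Δ ω y ≤
      K * L ^ 2 * (dP w Δ ω x + L ^ 2) := by
    intro x
    have h0 := dP_nonneg w Δ ω x
    have e1 : ∑ y, ind (ParE w Δ ω y x) * dP w Δ ω y ≤
        A * (∑ y, ind (Adj ω y x ∧ Δ * w y ≤ w x) * w y) + C * L ^ 2 * dP w Δ ω x := by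
      conv_rhs => rw [dP, Finset.mul_sum, Finset.mul_sum, ← Finset.sum_add_distrib]
      refine Finset.sum_le_sum fun y _ => ?_
      by_cases h : ParE w Δ ω y x
      · have hn : Δ * w y < w x := by
          have := h.2.2.1
          unfold near at this; push Not at this; exact this.2
        rw [ind_true h, ind_true ⟨h.2.1, hn.le⟩]
        linarith [(hdD y).trans (hg.E3 y)]
      · rw [ind_false h]
        have := mul_nonneg hA (mul_nonneg (ind_nonneg (Adj ω y x ∧ Δ * w y ≤ w x)) (hw y).le)
        simpa using this
    have e2 : Δ * (A * (∑ y, ind (Adj ω y x ∧ Δ * w y ≤ w x) * w y)) ≤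
        Δ * (L ^ 4 + 16 * L ^ 2 * (dP w Δ ω x + 2 * C * L ^ 2)) := by
      calc Δ * (A * (∑ y, ind (Adj ω y x ∧ Δ * w y ≤ w x) * w y))
          = A * (Δ * (∑ y, ind (Adj ω y x ∧ Δ * w y ≤ w x) * w y)) := by ring
        _ ≤ A * (X * w x) := mul_le_mul_of_nonneg_left (hg.E5 x) hA
        _ ≤ A * (X * (X + 16 * (dP w Δ ω x + 2 * C * L ^ 2))) :=
            mul_le_mul_of_nonneg_left (mul_le_mul_of_nonneg_left (hwx x) hX) hA
        _ = A * X ^ 2 + (A * X) * (16 * (dP w Δ ω x + 2 * C * L ^ 2)) := by ring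
        _ ≤ Δ * L ^ 4 + (Δ * L ^ 2) * (16 * (dP w Δ ω x + 2 * C * L ^ 2)) := by
            have : 0 ≤ 16 * (dP w Δ ω x + 2 * C * L ^ 2) := by positivity
            exact add_le_add hA2 (mul_le_mul_of_nonneg_right hA1 this)
        _ = _ := by ring
    have e3 := le_of_mul_le_mul_left e2 hΔ
    refine e1.trans ((add_le_add e3 le_rfl).trans ?_)
    have t1 : 0 ≤ L ^ 2 * dP w Δ ω x := by positivity
    have t2 : 0 ≤ L ^ 4 := by positivity
    rw [hK]; nlinarith
  have hDd' : ∀ x, (deg ω x : ℝ) ≤ dP w Δ ω x + K * L ^ 2 := fun x => by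
    have := hDd x; rw [hK]; nlinarith
  have hRem : ∀ v : Fin N → ℝ,
      |∑ y, ∑ x, ind (RemE w Δ ω y x) * v y * v x| ≤ K * L * ∑ x, v x ^ 2 := by
    intro v
    have := rem_form (RemE w Δ ω) (InR w Δ ω) (Ud w ω) L C θi θo hL hθi hθo hθ (fun x => rfl)
      (fun y => Finset.sum_le_sum fun x _ => ind_mono fun h => ⟨h.1, h.2.1⟩) hg.E1 hg.E2 v
    refine this.trans (mul_le_mul_of_nonneg_right
      (mul_le_mul_of_nonneg_right ?_ hL.le) (Finset.sum_nonneg fun _ _ => sq_nonneg _))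
    rw [hK]; linarith
  have hperm' : ∀ i j : Fin N, i ≤ j → (deg ω (perm j) : ℝ) ≤ deg ω (perm i) := by
    intro i j hij
    rcases hij.lt_or_eq with h | h
    · have := hperm i j h
      unfold precA at this
      have h' : degA (Adj ω) (perm j) ≤ degA (Adj ω) (perm i) := by
        rcases this with h | h
        · exact h.le
        · exact h.1.le
      exact_mod_cast h'
    · rw [h]
  have hK1 : 1 ≤ K := by rw [hK]; linarith
  obtain ⟨u, hu1, hu2⟩ := spectral (adjMatrix ω) hH
  constructor
  · intro hi
    refine assembly (ParE w Δ ω) (RemE w Δ ω) (dP w Δ ω) (fun x => (deg ω x : ℝ))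
      (ParE_uniq w Δ ω) (fun x => rfl) L K hL hK1 h1 h2 hdD hDd' hRem 1 (by norm_num)
      (hH.eigenvalues ∘ σ) hσ (fun j => u (σ j)) ?_ ?_ perm hperm' i hi
    · intro v
      rw [← hu1 v]
      exact Equiv.sum_comp σ (fun j => (∑ x, u j x * v x) ^ 2)
    · intro v
      rw [one_mul, one_mul, ← form_split, ← hu2 v]
      exact Equiv.sum_comp σ (fun j => hH.eigenvalues j * (∑ x, u j x * v x) ^ 2)
  · intro hi
    have := assembly (ParE w Δ ω) (RemE w Δ ω) (dP w Δ ω) (fun x => (deg ω x : ℝ))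
      (ParE_uniq w Δ ω) (fun x => rfl) L K hL hK1 h1 h2 hdD hDd' hRem (-1) (by norm_num)
      (fun j => - hH.eigenvalues (σ j.rev))
      (fun a b hab => neg_le_neg (hσ (Fin.rev_le_rev.2 hab)))
      (fun j => u (σ j.rev)) ?_ ?_ perm hperm' i.rev (by
        rw [Fin.rev_rev]; linarith)
    · rw [Fin.rev_rev] at this
      rw [← abs_neg, neg_add]
      exact this
    · intro v
      rw [← hu1 v]
      exact Equiv.sum_comp (Fin.revPerm.trans σ) (fun j => (∑ x, u j x * v x) ^ 2)
    · intro v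
      have := form_split w Δ ω v
      rw [← hu2 v] at this
      have h5 := Equiv.sum_comp (Fin.revPerm.trans σ)
        (fun j => hH.eigenvalues j * (∑ x, u j x * v x) ^ 2)
      simp only [Equiv.trans_apply, Fin.revPerm_apply] at h5
      simp only [neg_mul, Finset.sum_neg_distrib]
      rw [h5, this]; ring

end GRG
namespace GRG

section Exp

variable {ι V : Type*} [Fintype ι] [DecidableEq ι] [Fintype V] [DecidableEq V]

noncomputable def wt (p : ℝ) (b : Bool) : ℝ := if b then p else 1 - p

noncomputable def Pw (p : ι → ℝ) (ω : ι → Bool) : ℝ := ∏ e, wt (p e) (ω e)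

/-- Expectation for independent Bernoulli variables. -/
noncomputable def Ex (p : ι → ℝ) (f : (ι → Bool) → ℝ) : ℝ := ∑ ω, Pw p ω * f ω

lemma wt_nonneg {p : ℝ} (h0 : 0 ≤ p) (h1 : p ≤ 1) (b : Bool) : 0 ≤ wt p b := by
  unfold wt; split_ifs <;> linarith

lemma Pw_nonneg {p : ι → ℝ} (h0 : ∀ e, 0 ≤ p e) (h1 : ∀ e, p e ≤ 1) (ω : ι → Bool) :
    0 ≤ Pw p ω := Finset.prod_nonneg fun e _ => wt_nonneg (h0 e) (h1 e) _

lemma Ex_prod (p : ι → ℝ) (g : ι → Bool → ℝ) :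
    Ex p (fun ω => ∏ e, g e (ω e)) = ∏ e, (p e * g e true + (1 - p e) * g e false) := by
  unfold Ex Pw
  have : ∀ e, p e * g e true + (1 - p e) * g e false = ∑ b, wt (p e) b * g e b := by
    intro e; simp [wt]
  simp only [this]
  rw [Fintype.prod_sum]
  simp only [Finset.prod_mul_distrib]

lemma Ex_one (p : ι → ℝ) : Ex p (fun _ => 1) = 1 := by
  have := Ex_prod p (fun _ _ => 1)
  simpa using this

lemma Ex_single (p : ι → ℝ) (e : ι) (g : Bool → ℝ) :
    Ex p (fun ω => g (ω e)) = p e * g true + (1 - p e) * g false := by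
  have := Ex_prod p (fun e' b => if e' = e then g b else 1)
  have h1 : ∀ ω : ι → Bool, ∏ e', (if e' = e then g (ω e') else 1) = g (ω e) := by
    intro ω; rw [Finset.prod_ite_eq' Finset.univ e (fun e' => g (ω e'))]; simp
  simp only [h1] at this
  rw [this, Finset.prod_eq_single e]
  · simp
  · intro b _ hb; simp [hb]
  · simp

lemma Ex_mono {p : ι → ℝ} (h0 : ∀ e, 0 ≤ p e) (h1 : ∀ e, p e ≤ 1)
    {f g : (ι → Bool) → ℝ} (h : ∀ ω, f ω ≤ g ω) : Ex p f ≤ Ex p g :=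
  Finset.sum_le_sum fun ω _ => mul_le_mul_of_nonneg_left (h ω) (Pw_nonneg h0 h1 ω)

lemma Ex_nonneg {p : ι → ℝ} (h0 : ∀ e, 0 ≤ p e) (h1 : ∀ e, p e ≤ 1)
    {f : (ι → Bool) → ℝ} (h : ∀ ω, 0 ≤ f ω) : 0 ≤ Ex p f :=
  Finset.sum_nonneg fun ω _ => mul_nonneg (Pw_nonneg h0 h1 ω) (h ω)

lemma Ex_const_mul (p : ι → ℝ) (c : ℝ) (f : (ι → Bool) → ℝ) :
    Ex p (fun ω => c * f ω) = c * Ex p f := by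
  unfold Ex; rw [Finset.mul_sum]; exact Finset.sum_congr rfl fun ω _ => by ring

lemma Ex_add (p : ι → ℝ) (f g : (ι → Bool) → ℝ) :
    Ex p (fun ω => f ω + g ω) = Ex p f + Ex p g := by
  unfold Ex; simp [mul_add, Finset.sum_add_distrib]

lemma Ex_sum {κ : Type*} (s : Finset κ) (p : ι → ℝ) (f : κ → (ι → Bool) → ℝ) :
    Ex p (fun ω => ∑ k ∈ s, f k ω) = ∑ k ∈ s, Ex p (f k) := by
  unfold Ex; simp only [Finset.mul_sum]; rw [Finset.sum_comm]

/-- Extension by false. -/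
def extB (r : ι → V) (v : V) (η : {e // r e = v} → Bool) (e : ι) : Bool :=
  if h : r e = v then η ⟨e, h⟩ else false

def rowEquiv (r : ι → V) : (ι → Bool) ≃ ((v : V) → ({e // r e = v} → Bool)) where
  toFun ω := fun _ e => ω e.1
  invFun η := fun e => η (r e) ⟨e, rfl⟩
  left_inv ω := rfl
  right_inv η := by
    funext v e
    obtain ⟨e, rfl⟩ := e
    rfl

lemma Ex_rows_aux (p : ι → ℝ) (r : ι → V) (F : V → (ι → Bool) → ℝ)
    (hF : ∀ v ω ω', (∀ e, r e = v → ω e = ω' e) → F v ω = F v ω') :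
    Ex p (fun ω => ∏ v, F v ω) =
      ∏ v, ∑ η : {e // r e = v} → Bool, (∏ e, wt (p e.1) (η e)) * F v (extB r v η) := by
  rw [Fintype.prod_sum]
  unfold Ex
  refine Fintype.sum_equiv (rowEquiv r) _ _ fun ω => ?_
  rw [Finset.prod_mul_distrib]
  congr 1
  · unfold Pw
    rw [← Finset.prod_fiberwise Finset.univ r]
    refine Finset.prod_congr rfl fun v _ => ?_
    rw [Finset.prod_subtype (p := fun e => r e = v)]
    · rfl
    · intro e; simp
  · refine Finset.prod_congr rfl fun v _ => hF v _ _ fun e he => ?_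
    simp [extB, he, rowEquiv]

lemma Ex_rows (p : ι → ℝ) (r : ι → V) (F : V → (ι → Bool) → ℝ)
    (hF : ∀ v ω ω', (∀ e, r e = v → ω e = ω' e) → F v ω = F v ω') :
    Ex p (fun ω => ∏ v, F v ω) = ∏ v, Ex p (F v) := by
  rw [Ex_rows_aux p r F hF]
  refine Finset.prod_congr rfl fun v _ => ?_
  have h := Ex_rows_aux p r (fun v' ω => if v' = v then F v ω else 1) (by
    intro v' ω ω' h
    by_cases hv : v' = v
    · subst hv; simp only [if_true]; exact hF _ _ _ h
    · simp [hv])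
  have h1 : ∀ ω, ∏ v', (if v' = v then F v ω else 1) = F v ω := by
    intro ω; simp
  simp only [h1] at h
  rw [h, Finset.prod_eq_single v]
  · simp
  · intro b _ hb
    have := Ex_one (ι := {e // r e = b}) (fun e => p e.1)
    unfold Ex Pw at this
    simp only [hb, if_false]; exact this
  · simp

lemma one_add_prod_le {κ : Type*} (s : Finset κ) (q : κ → ℝ) (h : ∀ k, 0 ≤ q k) :
    ∏ k ∈ s, (1 + q k) ≤ Real.exp (∑ k ∈ s, q k) := by
  rw [Real.exp_sum]
  refine Finset.prod_le_prod (fun k _ => by linarith [h k]) fun k _ => ?_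
  linarith [Real.add_one_le_exp (q k)]

end Exp

lemma bern_singleton (p : ℝ) (b : Bool) : bern p {b} = ENNReal.ofReal (wt p b) := by
  cases b <;> simp [bern, wt]

variable {N : ℕ}

/-- edge probabilities -/
noncomputable def pe (w : Fin N → ℝ) (e : EdgeIdx N) : ℝ := pGRG w e.val.1 e.val.2

lemma pG_nonneg {w : Fin N → ℝ} (hw : ∀ x, 0 < w x) (x y : Fin N) : 0 ≤ pGRG w x y := by
  have : 0 ≤ ∑ z, w z := Finset.sum_nonneg fun z _ => (hw z).le
  have := mul_pos (hw x) (hw y)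
  unfold pGRG; positivity

lemma pG_le_one {w : Fin N → ℝ} (hw : ∀ x, 0 < w x) (x y : Fin N) : pGRG w x y ≤ 1 := by
  have : 0 ≤ ∑ z, w z := Finset.sum_nonneg fun z _ => (hw z).le
  have := mul_pos (hw x) (hw y)
  unfold pGRG; rw [div_le_one (by positivity)]; linarith

lemma pG_symm (w : Fin N → ℝ) (x y : Fin N) : pGRG w x y = pGRG w y x := by
  unfold pGRG; rw [mul_comm (w x)]

lemma measure_of_Ex {w : Fin N → ℝ} (hw : ∀ x, 0 < w x) (S : Set (EdgeIdx N → Bool)) (b : ℝ)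
    (h : Ex (pe w) (fun ω => ind (ω ∉ S)) ≤ b) :
    1 - ENNReal.ofReal b ≤ grgMeasure w S := by
  classical
  have h0 : ∀ e, 0 ≤ pe w e := fun e => pG_nonneg hw _ _
  have h1 : ∀ e, pe w e ≤ 1 := fun e => pG_le_one hw _ _
  have key : ∀ T : Set (EdgeIdx N → Bool),
      grgMeasure w T = ENNReal.ofReal (Ex (pe w) (fun ω => ind (ω ∈ T))) := by
    intro T
    have e1 : grgMeasure w T = ∑ ω ∈ T.toFinset, grgMeasure w {ω} := by
      rw [MeasureTheory.sum_measure_singleton]; simp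
    rw [e1]
    unfold Ex
    rw [ENNReal.ofReal_sum_of_nonneg (fun ω _ =>
      mul_nonneg (Pw_nonneg h0 h1 ω) (ind_nonneg _))]
    have e2 : ∀ ω, grgMeasure w {ω} = ENNReal.ofReal (Pw (pe w) ω) := by
      intro ω
      unfold grgMeasure
      rw [Measure.pi_singleton]
      simp only [bern_singleton]
      unfold Pw
      rw [ENNReal.ofReal_prod_of_nonneg (fun e _ => wt_nonneg (h0 e) (h1 e) _)]
      rfl
    have e3 : ∀ ω, ENNReal.ofReal (Pw (pe w) ω * ind (ω ∈ T)) =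
        if ω ∈ T then grgMeasure w {ω} else 0 := by
      intro ω
      split_ifs with h
      · rw [ind_true h, mul_one, e2]
      · rw [ind_false h, mul_zero, ENNReal.ofReal_zero]
    simp only [e3]
    rw [← Finset.sum_filter]
    congr 1
    ext ω; simp
  rw [key S, ← ENNReal.ofReal_one, ← ENNReal.ofReal_sub _ (le_trans (Ex_nonneg h0 h1 fun _ => ind_nonneg _) h)]
  apply ENNReal.ofReal_le_ofReal
  have : Ex (pe w) (fun ω => ind (ω ∈ S) + ind (ω ∉ S)) = 1 := by
    rw [← Ex_one (pe w)]
    congr 1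
    funext ω
    by_cases h : ω ∈ S <;> simp [ind, h]
  rw [Ex_add] at this
  linarith

/-- lower/upper endpoint -/
noncomputable def xi' (w : Fin N → ℝ) (y x : Fin N) (ω : EdgeIdx N → Bool) : ℝ :=
  ind (up w y x ∧ Adj ω y x)

open Classical in
noncomputable def lo (w : Fin N → ℝ) (e : EdgeIdx N) : Fin N :=
  if up w e.val.1 e.val.2 then e.val.1 else e.val.2

open Classical in
noncomputable def hiE (w : Fin N → ℝ) (e : EdgeIdx N) : Fin N :=
  if up w e.val.1 e.val.2 then e.val.2 else e.val.1

lemma adj_iff_lt (ω : EdgeIdx N → Bool) {x y : Fin N} (h : x < y) :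
    Adj ω x y ↔ ω ⟨(x, y), h⟩ = true := by
  unfold Adj adjMatrix
  rw [dif_pos h]; simp

lemma adj_edge {x y : Fin N} (h : x ≠ y) :
    ∃ e : EdgeIdx N, ((e.val.1 = x ∧ e.val.2 = y) ∨ (e.val.1 = y ∧ e.val.2 = x)) ∧
      ∀ ω, Adj ω x y ↔ ω e = true := by
  rcases lt_or_gt_of_ne h with h | h
  · exact ⟨⟨(x, y), h⟩, Or.inl ⟨rfl, rfl⟩, fun ω => adj_iff_lt ω h⟩
  · exact ⟨⟨(y, x), h⟩, Or.inr ⟨rfl, rfl⟩, fun ω => by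
      rw [adj_symm]; exact adj_iff_lt ω h⟩

lemma up_edge (w : Fin N → ℝ) {x y : Fin N} (h : up w y x) :
    ∃ e : EdgeIdx N, lo w e = y ∧ hiE w e = x ∧ pe w e = pGRG w y x ∧
      ∀ ω, Adj ω y x ↔ ω e = true := by
  have hne : y ≠ x := by rintro rfl; exact up_irrefl w _ h
  obtain ⟨e, he, hω⟩ := adj_edge hne
  refine ⟨e, ?_, ?_, ?_, hω⟩
  all_goals
    rcases he with ⟨h1, h2⟩ | ⟨h1, h2⟩
    · simp [lo, hiE, pe, h1, h2, h]
    · simp [lo, hiE, pe, h1, h2, up_asymm w h, pG_symm w]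

/-- Upper-edge probability. -/
noncomputable def qq (w : Fin N → ℝ) (y x : Fin N) : ℝ := ind (up w y x) * pGRG w y x

lemma Ex_xi (w : Fin N → ℝ) (y x : Fin N) (a b : ℝ) :
    Ex (pe w) (fun ω => a + b * xi' w y x ω) = a + b * qq w y x := by
  by_cases h : up w y x
  · obtain ⟨e, -, -, hp, hω⟩ := up_edge w h
    have : (fun ω => a + b * xi' w y x ω) =
        fun ω : EdgeIdx N → Bool => (fun c : Bool => a + b * (if c then 1 else 0)) (ω e) := by
      funext ω; simp [xi', ind, h, hω]
    rw [this, Ex_single (pe w) e (fun c : Bool => a + b * (if c then 1 else 0)), hp, qq,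
      ind_true h]
    simp; ring
  · have h2 : ∀ ω, xi' w y x ω = 0 := fun ω => by simp [xi', ind, h]
    simp only [h2, qq, ind_false h]
    have := Ex_const_mul (pe w) a (fun _ => 1)
    rw [Ex_one] at this
    simpa using this

lemma xi_dep (w : Fin N → ℝ) (y x : Fin N) (ω ω' : EdgeIdx N → Bool)
    (h : ∀ e, lo w e = y → hiE w e = x → ω e = ω' e) : xi' w y x ω = xi' w y x ω' := by
  unfold xi'
  by_cases hu : up w y x
  · obtain ⟨e, h1, h2, -, hω⟩ := up_edge w hu
    simp only [hω, h e h1 h2]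
  · simp [ind, hu]

lemma Ex_row_prod (w : Fin N → ℝ) (y : Fin N) (a b : Fin N → ℝ) :
    Ex (pe w) (fun ω => ∏ x, (a x + b x * xi' w y x ω)) = ∏ x, (a x + b x * qq w y x) := by
  classical
  rw [Ex_rows (pe w) (hiE w) (fun x ω => a x + b x * xi' w y x ω)]
  · exact Finset.prod_congr rfl fun x _ => Ex_xi w y x _ _
  · intro x ω ω' h
    rw [xi_dep w y x ω ω' fun e _ he => h e he]

open Classical in
/-- Product over all edges at a vertex. -/
lemma Ex_deg_prod (w : Fin N → ℝ) (x : Fin N) (a b : Fin N → ℝ) :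
    Ex (pe w) (fun ω => ∏ y, (a y + b y * ind (Adj ω x y))) =
      ∏ y, (a y + b y * (if y = x then 0 else pGRG w x y)) := by
  rw [Ex_rows (pe w) (fun e => if e.val.1 = x then e.val.2 else e.val.1)
    (fun y ω => a y + b y * ind (Adj ω x y))]
  · refine Finset.prod_congr rfl fun y _ => ?_
    by_cases h : y = x
    · subst h
      simp only [ind_false (adj_irrefl _ y), if_true]
      have := Ex_const_mul (pe w) (a y) (fun _ => 1)
      rw [Ex_one] at this
      simpa using this
    · obtain ⟨e, he, hω⟩ := adj_edge (Ne.symm h)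
      have : (fun ω => a y + b y * ind (Adj ω x y)) =
          fun ω : EdgeIdx N → Bool => (fun c : Bool => a y + b y * (if c then 1 else 0)) (ω e) := by
        funext ω; simp [ind, hω]
      rw [this, Ex_single (pe w) e (fun c : Bool => a y + b y * (if c then 1 else 0)), if_neg h]
      have hp : pe w e = pGRG w x y := by
        rcases he with ⟨h1, h2⟩ | ⟨h1, h2⟩
        · simp [pe, h1, h2]
        · simp [pe, h1, h2, pG_symm w y x]
      rw [hp]; simp; ring
  · intro y ω ω' h
    by_cases hne : x = y
    · subst hne; simp [ind, adj_irrefl]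
    · obtain ⟨e, he, hω⟩ := adj_edge hne
      have : (if e.val.1 = x then e.val.2 else e.val.1) = y := by
        rcases he with ⟨h1, h2⟩ | ⟨h1, h2⟩
        · simp [h1, h2]
        · rw [h1, if_neg (Ne.symm hne)]
      simp only [hω, h e this]

end GRG
namespace GRG

variable {N : ℕ}

lemma pG_le {w : Fin N → ℝ} (hw : ∀ x, 0 < w x) (x y : Fin N) :
    pGRG w x y ≤ w x * w y / ∑ z, w z := by
  have h0 : 0 < ∑ z, w z := Finset.sum_pos (fun z _ => hw z) ⟨x, Finset.mem_univ _⟩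
  have := mul_pos (hw x) (hw y)
  unfold pGRG
  exact div_le_div_of_nonneg_left this.le h0 (by linarith)

lemma qq_nonneg {w : Fin N → ℝ} (hw : ∀ x, 0 < w x) (y x : Fin N) : 0 ≤ qq w y x :=
  mul_nonneg (ind_nonneg _) (pG_nonneg hw _ _)

lemma qq_le {w : Fin N → ℝ} (hw : ∀ x, 0 < w x) (y x : Fin N) :
    qq w y x ≤ w y * w x / ∑ z, w z :=
  (mul_le_of_le_one_left (pG_nonneg hw _ _) (ind_le_one _)).trans (pG_le hw y x)

lemma sum_qq_le {w : Fin N → ℝ} (hw : ∀ x, 0 < w x) {Δ : ℝ}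
    (hm : ∑ z, w z ^ 2 ≤ Δ * ∑ z, w z) (y : Fin N) : ∑ x, qq w y x ≤ Δ := by
  have h0 : 0 < ∑ z, w z := Finset.sum_pos (fun z _ => hw z) ⟨y, Finset.mem_univ _⟩
  calc ∑ x, qq w y x ≤ ∑ x, w x ^ 2 / ∑ z, w z := by
        refine Finset.sum_le_sum fun x _ => ?_
        by_cases h : up w y x
        · refine (qq_le hw y x).trans ?_
          have := up_le w h
          have := (hw x).le
          rw [sq]; gcongr
        · rw [qq, ind_false h, zero_mul]; positivity
    _ = (∑ x, w x ^ 2) / ∑ z, w z := by rw [Finset.sum_div]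
    _ ≤ Δ := by rw [div_le_iff₀ h0]; exact hm

noncomputable def rr (w : Fin N → ℝ) (Δ : ℝ) (y x : Fin N) : ℝ :=
  qq w y x * (ind (near w Δ y x) + ∑ z, ind (up w x z) * qq w y z)

lemma rr_nonneg {w : Fin N → ℝ} (hw : ∀ x, 0 < w x) (Δ : ℝ) (y x : Fin N) : 0 ≤ rr w Δ y x :=
  mul_nonneg (qq_nonneg hw _ _) (add_nonneg (ind_nonneg _)
    (Finset.sum_nonneg fun _ _ => mul_nonneg (ind_nonneg _) (qq_nonneg hw _ _)))

lemma sum_rr_le {w : Fin N → ℝ} (hw : ∀ x, 0 < w x) {Δ : ℝ} (hΔ : 0 < Δ)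
    (hm : ∑ z, w z ^ 2 ≤ Δ * ∑ z, w z) (x : Fin N) : ∑ y, rr w Δ y x ≤ 2 * Δ ^ 2 := by
  have h0 : 0 < ∑ z, w z := Finset.sum_pos (fun z _ => hw z) ⟨x, Finset.mem_univ _⟩
  set S := ∑ z, w z with hS
  have hx := hw x
  have hnear : ∑ y, qq w y x * ind (near w Δ y x) ≤ Δ ^ 2 := by
    by_cases hc : w x ≤ Δ ^ 2
    · calc ∑ y, qq w y x * ind (near w Δ y x) ≤ ∑ y, w y * w x / S := by
            refine Finset.sum_le_sum fun y _ => ?_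
            exact (mul_le_of_le_one_right (qq_nonneg hw _ _) (ind_le_one _)).trans (qq_le hw y x)
        _ = w x := by
            rw [← Finset.sum_div, ← Finset.sum_mul, ← hS]; field_simp
        _ ≤ _ := hc
    · calc ∑ y, qq w y x * ind (near w Δ y x) ≤ ∑ y, Δ * (w y ^ 2 / S) := by
            refine Finset.sum_le_sum fun y _ => ?_
            have hy := hw y
            by_cases h : near w Δ y x
            · rw [ind_true h, mul_one]
              have h' : w x ≤ Δ * w y := h.resolve_left hc
              refine (qq_le hw y x).trans ?_
              rw [← mul_div_assoc]
              apply div_le_div_of_nonneg_right _ h0.le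
              nlinarith
            · rw [ind_false h, mul_zero]; positivity
        _ = Δ * ((∑ y, w y ^ 2) / S) := by rw [← Finset.mul_sum, Finset.sum_div]
        _ ≤ Δ * Δ := by
            apply mul_le_mul_of_nonneg_left _ hΔ.le
            rw [div_le_iff₀ h0]; exact hm
        _ = _ := by ring
  have hfar : ∀ y, ∑ z, ind (up w x z) * qq w y z ≤ w y * Δ / w x := by
    intro y
    have hy := hw y
    calc ∑ z, ind (up w x z) * qq w y z ≤ ∑ z, (w y / w x) * (w z ^ 2 / S) := by
          refine Finset.sum_le_sum fun z _ => ?_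
          have hz := hw z
          by_cases h : up w x z
          · rw [ind_true h, one_mul]
            refine (qq_le hw y z).trans ?_
            have h1 := up_le w h
            rw [div_mul_div_comm, div_le_div_iff₀ h0 (by positivity)]
            have : w y * w z * w x ≤ w y * w z ^ 2 := by
              rw [sq, ← mul_assoc]; gcongr
            calc w y * w z * (w x * S) = (w y * w z * w x) * S := by ring
              _ ≤ _ := mul_le_mul_of_nonneg_right this h0.le
          · rw [ind_false h, zero_mul]; positivity
      _ = (w y / w x) * ((∑ y, w y ^ 2) / S) := by rw [← Finset.mul_sum, Finset.sum_div]
      _ ≤ (w y / w x) * Δ := by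
            apply mul_le_mul_of_nonneg_left _ (by positivity)
            rw [div_le_iff₀ h0]; exact hm
      _ = _ := by ring
  have hfar2 : ∑ y, qq w y x * ∑ z, ind (up w x z) * qq w y z ≤ Δ ^ 2 := by
    calc ∑ y, qq w y x * ∑ z, ind (up w x z) * qq w y z
        ≤ ∑ y, Δ * (w y ^ 2 / S) := by
          refine Finset.sum_le_sum fun y _ => ?_
          have hy := hw y
          calc qq w y x * ∑ z, ind (up w x z) * qq w y z
              ≤ (w y * w x / S) * (w y * Δ / w x) :=
                mul_le_mul (qq_le hw y x) (hfar y)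
                  (Finset.sum_nonneg fun _ _ => mul_nonneg (ind_nonneg _) (qq_nonneg hw _ _))
                  (by positivity)
            _ = _ := by field_simp
      _ = Δ * ((∑ y, w y ^ 2) / S) := by rw [← Finset.mul_sum, Finset.sum_div]
      _ ≤ Δ * Δ := by
            apply mul_le_mul_of_nonneg_left _ hΔ.le
            rw [div_le_iff₀ h0]; exact hm
      _ = _ := by ring
  simp only [rr, mul_add, Finset.sum_add_distrib]
  linarith

lemma xi_cases (w : Fin N → ℝ) (y x : Fin N) (ω : EdgeIdx N → Bool) :
    xi' w y x ω = 0 ∨ xi' w y x ω = 1 := by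
  unfold xi' ind; split_ifs <;> simp

lemma exp_ind (b : ℝ) (P : Prop) : Real.exp (b * ind P) = 1 + (Real.exp b - 1) * ind P := by
  by_cases h : P
  · rw [ind_true h]; simp
  · rw [ind_false h]; simp

open Classical in
/-- Joint bound within one row. -/
lemma J_bound {w : Fin N → ℝ} (hw : ∀ x, 0 < w x) (y : Fin N) (g : Fin N → ℝ) (G : ℝ)
    (hg : ∀ x, 0 ≤ g x) (hG : ∀ x, g x ≤ G) (J : Finset (Fin N)) :
    Ex (pe w) (fun ω => (∏ x ∈ J, xi' w y x ω) * ∏ x, (1 + g x * xi' w y x ω)) ≤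
      (∏ x ∈ J, ((1 + G) * qq w y x)) * Real.exp (∑ x, g x * qq w y x) := by
  have hq := qq_nonneg hw y
  have e1 : (fun ω => (∏ x ∈ J, xi' w y x ω) * ∏ x, (1 + g x * xi' w y x ω)) =
      fun ω => ∏ x, ((if x ∈ J then 0 else 1) + (if x ∈ J then 1 + g x else g x) * xi' w y x ω) := by
    funext ω
    rw [← Finset.prod_ite_mem_eq, ← Finset.prod_mul_distrib]
    refine Finset.prod_congr rfl fun x _ => ?_
    by_cases h : x ∈ J
    · simp only [h, if_true]
      rcases xi_cases w y x ω with h | h <;> rw [h] <;> ring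
    · simp only [h, if_false]; ring
  rw [e1, Ex_row_prod]
  have e2 : (∏ x ∈ J, ((1 + G) * qq w y x)) * Real.exp (∑ x, g x * qq w y x) =
      ∏ x, ((if x ∈ J then (1 + G) * qq w y x else 1) * Real.exp (g x * qq w y x)) := by
    rw [Real.exp_sum, ← Finset.prod_ite_mem_eq J (fun x => (1 + G) * qq w y x),
      ← Finset.prod_mul_distrib]
  rw [e2]
  refine Finset.prod_le_prod (fun x _ => ?_) (fun x _ => ?_)
  · have := hg x
    have := hq x
    split_ifs <;> positivity
  · have h1 := hg x
    have h2 := hq x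
    have h3 := Real.add_one_le_exp (g x * qq w y x)
    have h4 : 0 ≤ g x * qq w y x := by positivity
    split_ifs
    · have h5 : (1 + g x) * qq w y x ≤ (1 + G) * qq w y x :=
        mul_le_mul_of_nonneg_right (by linarith [hG x]) h2
      have h6 : 0 ≤ (1 + G) * qq w y x := mul_nonneg (by linarith [hG x]) h2
      nlinarith
    · linarith

lemma pe_nonneg {w : Fin N → ℝ} (hw : ∀ x, 0 < w x) (e : EdgeIdx N) : 0 ≤ pe w e :=
  pG_nonneg hw _ _
lemma pe_le_one {w : Fin N → ℝ} (hw : ∀ x, 0 < w x) (e : EdgeIdx N) : pe w e ≤ 1 :=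
  pG_le_one hw _ _

lemma rem_ind_le (w : Fin N → ℝ) (Δ : ℝ) (ω : EdgeIdx N → Bool) (y x : Fin N) :
    ind (RemE w Δ ω y x) ≤ xi' w y x ω * ind (near w Δ y x) +
      ∑ z, ind (up w x z) * (xi' w y x ω * xi' w y z ω) := by
  have hnn : ∀ z, 0 ≤ ind (up w x z) * (xi' w y x ω * xi' w y z ω) := fun z =>
    mul_nonneg (ind_nonneg _) (mul_nonneg (ind_nonneg _) (ind_nonneg _))
  have hs := Finset.sum_nonneg fun z (_ : z ∈ Finset.univ) => hnn z
  have h0 : 0 ≤ xi' w y x ω * ind (near w Δ y x) := mul_nonneg (ind_nonneg _) (ind_nonneg _)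
  by_cases h : RemE w Δ ω y x
  · rw [ind_true h]
    obtain ⟨h1, h2, h3⟩ := h
    have hx : xi' w y x ω = 1 := ind_true ⟨h1, h2⟩
    rcases h3 with h3 | ⟨z, hz, hz'⟩
    · have : xi' w y x ω * ind (near w Δ y x) = 1 := by rw [hx, ind_true h3, one_mul]
      linarith
    · have hyz : up w y z := by
        unfold up at *
        rcases h1 with h1 | h1 <;> rcases hz with hz | hz
        · exact Or.inl (h1.trans hz)
        · exact Or.inl (by rw [← hz.1]; exact h1)
        · exact Or.inl (by rw [h1.1]; exact hz)
        · exact Or.inr ⟨h1.1.trans hz.1, h1.2.trans hz.2⟩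
      have := Finset.single_le_sum (fun z _ => hnn z) (Finset.mem_univ z)
      have h5 : ind (up w x z) * (xi' w y x ω * xi' w y z ω) = 1 := by
        rw [hx, ind_true hz, show xi' w y z ω = 1 from ind_true ⟨hyz, hz'⟩]; norm_num
      linarith
  · rw [ind_false h]; linarith

lemma row_J {w : Fin N → ℝ} (hw : ∀ x, 0 < w x) (Δ : ℝ) (y x : Fin N) (g : Fin N → ℝ) (G : ℝ)
    (hg : ∀ x, 0 ≤ g x) (hG : ∀ x, g x ≤ G) :
    Ex (pe w) (fun ω => ind (RemE w Δ ω y x) * ∏ x, (1 + g x * xi' w y x ω)) ≤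
      rr w Δ y x * ((1 + G) ^ 2 * Real.exp (∑ x, g x * qq w y x)) := by
  classical
  set P : (EdgeIdx N → Bool) → ℝ := fun ω => ∏ x, (1 + g x * xi' w y x ω) with hP
  have hP0 : ∀ ω, 0 ≤ P ω := fun ω => Finset.prod_nonneg fun z _ => by
    have := mul_nonneg (hg z) (ind_nonneg (up w y z ∧ Adj ω y z))
    unfold xi'; linarith
  have hG0 : 0 ≤ G := (hg x).trans (hG x)
  set E := Real.exp (∑ x, g x * qq w y x) with hE
  have hE0 : 0 < E := Real.exp_pos _
  have step1 : Ex (pe w) (fun ω => ind (RemE w Δ ω y x) * P ω) ≤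
      Ex (pe w) (fun ω => ind (near w Δ y x) * (xi' w y x ω * P ω) +
        ∑ z, ind (up w x z) * (xi' w y x ω * xi' w y z ω * P ω)) := by
    refine Ex_mono (pe_nonneg hw) (pe_le_one hw) fun ω => ?_
    refine (mul_le_mul_of_nonneg_right (rem_ind_le w Δ ω y x) (hP0 ω)).trans (le_of_eq ?_)
    rw [add_mul, Finset.sum_mul]
    congr 1
    · ring
    · exact Finset.sum_congr rfl fun z _ => by ring
  refine step1.trans ?_
  rw [Ex_add, Ex_const_mul, Ex_sum]
  have b1 : Ex (pe w) (fun ω => xi' w y x ω * P ω) ≤ (1 + G) ^ 2 * E * qq w y x := by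
    have := J_bound hw y g G hg hG {x}
    simp only [Finset.prod_singleton] at this
    refine this.trans ?_
    rw [← hE]
    have h1 : 0 ≤ qq w y x * E := mul_nonneg (qq_nonneg hw _ _) hE0.le
    have h2 : (1 + G) * (qq w y x * E) ≤ (1 + G) ^ 2 * (qq w y x * E) :=
      mul_le_mul_of_nonneg_right (by nlinarith) h1
    linarith
  have b2 : ∀ z, Ex (pe w) (fun ω => ind (up w x z) * (xi' w y x ω * xi' w y z ω * P ω)) ≤
      (1 + G) ^ 2 * E * (qq w y x * (ind (up w x z) * qq w y z)) := by
    intro z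
    rw [Ex_const_mul]
    by_cases hz : up w x z
    · have hne : x ≠ z := by rintro rfl; exact up_irrefl w _ hz
      have := J_bound hw y g G hg hG {x, z}
      simp only [Finset.prod_pair hne] at this
      rw [ind_true hz]
      rw [← hE] at this
      refine (le_of_eq (one_mul _)).trans (this.trans (le_of_eq ?_))
      ring
    · rw [ind_false hz]; simp
  calc _ ≤ ind (near w Δ y x) * ((1 + G) ^ 2 * E * qq w y x) +
        ∑ z, (1 + G) ^ 2 * E * (qq w y x * (ind (up w x z) * qq w y z)) :=
        add_le_add (mul_le_mul_of_nonneg_left b1 (ind_nonneg _))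
          (Finset.sum_le_sum fun z _ => b2 z)
    _ = _ := by
        rw [rr, ← Finset.mul_sum, ← Finset.mul_sum]; ring

end GRG
namespace GRG

variable {N : ℕ}

lemma markov {w : Fin N → ℝ} (hw : ∀ x, 0 < w x) (P : (EdgeIdx N → Bool) → Prop)
    (f : (EdgeIdx N → Bool) → ℝ) (t : ℝ) (hf : ∀ ω, 0 ≤ f ω)
    (h : ∀ ω, P ω → Real.exp t ≤ f ω) :
    Ex (pe w) (fun ω => ind (P ω)) ≤ Real.exp (-t) * Ex (pe w) f := by
  rw [← Ex_const_mul]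
  refine Ex_mono (pe_nonneg hw) (pe_le_one hw) fun ω => ?_
  by_cases hP : P ω
  · rw [ind_true hP]
    have := mul_le_mul_of_nonneg_left (h ω hP) (Real.exp_pos (-t)).le
    rwa [← Real.exp_add, neg_add_cancel, Real.exp_zero] at this
  · rw [ind_false hP]; exact mul_nonneg (Real.exp_pos _).le (hf ω)

lemma exp_Ud (w : Fin N → ℝ) (b : ℝ) (y : Fin N) (ω : EdgeIdx N → Bool) :
    Real.exp (b * Ud w ω y) = ∏ x, (1 + (Real.exp b - 1) * xi' w y x ω) := by
  rw [Ud, Finset.mul_sum, Real.exp_sum]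
  exact Finset.prod_congr rfl fun x _ => exp_ind _ _

lemma prob_U {w : Fin N → ℝ} (hw : ∀ x, 0 < w x) {Δ : ℝ}
    (hm : ∑ z, w z ^ 2 ≤ Δ * ∑ z, w z) (b t : ℝ) (hb : 0 ≤ b) (y : Fin N) :
    Ex (pe w) (fun ω => ind (t < Ud w ω y)) ≤ Real.exp (Real.exp b * Δ - b * t) := by
  refine (markov hw _ (fun ω => Real.exp (b * Ud w ω y)) (b * t) (fun ω => (Real.exp_pos _).le)
    (fun ω h => Real.exp_le_exp.2 (mul_le_mul_of_nonneg_left h.le hb))).trans ?_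
  simp only [exp_Ud]
  rw [Ex_row_prod, sub_eq_neg_add (Real.exp b * Δ), Real.exp_add]
  refine mul_le_mul_of_nonneg_left ?_ (Real.exp_pos _).le
  have hb1 : 0 ≤ Real.exp b - 1 := by linarith [Real.add_one_le_exp b]
  refine (one_add_prod_le _ _ fun x => mul_nonneg hb1 (qq_nonneg hw y x)).trans ?_
  rw [← Finset.mul_sum]
  apply Real.exp_le_exp.2
  refine mul_le_mul (by linarith) (sum_qq_le hw hm y)
    (Finset.sum_nonneg fun x _ => qq_nonneg hw y x) (Real.exp_pos _).le

lemma rem_dep (w : Fin N → ℝ) (Δ : ℝ) (y x : Fin N) (ω ω' : EdgeIdx N → Bool)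
    (h : ∀ e, lo w e = y → ω e = ω' e) : ind (RemE w Δ ω y x) = ind (RemE w Δ ω' y x) := by
  have hadj : ∀ z, up w y z → (Adj ω y z ↔ Adj ω' y z) := by
    intro z hz
    obtain ⟨e, h1, -, -, hω⟩ := up_edge w hz
    rw [hω, hω, h e h1]
  have htr : ∀ z, up w y x → up w x z → up w y z := by
    intro z h1 hz
    unfold up at *
    rcases h1 with h1 | h1 <;> rcases hz with hz | hz
    · exact Or.inl (h1.trans hz)
    · exact Or.inl (by rw [← hz.1]; exact h1)
    · exact Or.inl (by rw [h1.1]; exact hz)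
    · exact Or.inr ⟨h1.1.trans hz.1, h1.2.trans hz.2⟩
  congr 1
  apply propext
  unfold RemE
  constructor
  · rintro ⟨h1, h2, h3⟩
    refine ⟨h1, (hadj x h1).1 h2, ?_⟩
    rcases h3 with h3 | ⟨z, hz, hz'⟩
    · exact Or.inl h3
    · exact Or.inr ⟨z, hz, (hadj z (htr z h1 hz)).1 hz'⟩
  · rintro ⟨h1, h2, h3⟩
    refine ⟨h1, (hadj x h1).2 h2, ?_⟩
    rcases h3 with h3 | ⟨z, hz, hz'⟩
    · exact Or.inl h3
    · exact Or.inr ⟨z, hz, (hadj z (htr z h1 hz)).2 hz'⟩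

lemma Ud_dep (w : Fin N → ℝ) (y : Fin N) (ω ω' : EdgeIdx N → Bool)
    (h : ∀ e, lo w e = y → ω e = ω' e) : Ud w ω y = Ud w ω' y :=
  Finset.sum_congr rfl fun x _ => xi_dep w y x ω ω' fun e he _ => h e he

lemma prob_E2 {w : Fin N → ℝ} (hw : ∀ x, 0 < w x) {Δ : ℝ} (hΔ : 0 < Δ)
    (hm : ∑ z, w z ^ 2 ≤ Δ * ∑ z, w z) (b t θ : ℝ) (hb : 0 ≤ b)
    (hθ : Real.exp (-(b * θ)) * (2 * Δ ^ 2 * (Real.exp (2 * b) ^ 2 *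
      Real.exp (Real.exp (2 * b) * Δ))) ≤ 1) (x : Fin N) :
    Ex (pe w) (fun ω => ind (t < ∑ y, ind (RemE w Δ ω y x ∧ θ ≤ Ud w ω y) * Ud w ω y)) ≤
      Real.exp (1 - b * t) := by
  classical
  have hb1 : 0 ≤ Real.exp (2 * b) - 1 := by linarith [Real.add_one_le_exp (2 * b)]
  refine (markov hw _ (fun ω => Real.exp
    (b * ∑ y, ind (RemE w Δ ω y x ∧ θ ≤ Ud w ω y) * Ud w ω y)) (b * t)
    (fun ω => (Real.exp_pos _).le)
    (fun ω h => Real.exp_le_exp.2 (mul_le_mul_of_nonneg_left h.le hb))).trans ?_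
  rw [sub_eq_neg_add, Real.exp_add]
  refine mul_le_mul_of_nonneg_left ?_ (Real.exp_pos _).le
  have step1 : Ex (pe w) (fun ω => Real.exp
      (b * ∑ y, ind (RemE w Δ ω y x ∧ θ ≤ Ud w ω y) * Ud w ω y)) ≤
      Ex (pe w) (fun ω => ∏ y, (1 + Real.exp (-(b * θ)) *
        (ind (RemE w Δ ω y x) * Real.exp (2 * b * Ud w ω y)))) := by
    refine Ex_mono (pe_nonneg hw) (pe_le_one hw) fun ω => ?_
    rw [Finset.mul_sum, Real.exp_sum]
    refine Finset.prod_le_prod (fun _ _ => (Real.exp_pos _).le) fun y _ => ?_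
    by_cases h : RemE w Δ ω y x ∧ θ ≤ Ud w ω y
    · rw [ind_true h, ind_true h.1, one_mul, one_mul, ← Real.exp_add]
      have : Real.exp (b * Ud w ω y) ≤ Real.exp (-(b * θ) + 2 * b * Ud w ω y) := by
        apply Real.exp_le_exp.2; nlinarith [h.2]
      linarith
    · rw [ind_false h, zero_mul, mul_zero, Real.exp_zero]
      have := mul_nonneg (Real.exp_pos (-(b * θ))).le
        (mul_nonneg (ind_nonneg (RemE w Δ ω y x)) (Real.exp_pos (2 * b * Ud w ω y)).le)
      linarith
  refine step1.trans ?_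
  rw [Ex_rows (pe w) (lo w) (fun y ω => 1 + Real.exp (-(b * θ)) *
        (ind (RemE w Δ ω y x) * Real.exp (2 * b * Ud w ω y)))
    (fun y ω ω' h => by rw [rem_dep w Δ y x ω ω' h, Ud_dep w y ω ω' h])]
  set E := Real.exp (2 * b) ^ 2 * Real.exp (Real.exp (2 * b) * Δ) with hE
  have hbound : ∀ y, Ex (pe w) (fun ω => 1 + Real.exp (-(b * θ)) *
        (ind (RemE w Δ ω y x) * Real.exp (2 * b * Ud w ω y))) ≤
      1 + Real.exp (-(b * θ)) * (rr w Δ y x * E) := by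
    intro y
    rw [Ex_add, Ex_one, Ex_const_mul]
    refine add_le_add le_rfl (mul_le_mul_of_nonneg_left ?_ (Real.exp_pos _).le)
    simp only [exp_Ud]
    refine (row_J hw Δ y x (fun _ => Real.exp (2 * b) - 1) (Real.exp (2 * b) - 1)
      (fun _ => hb1) (fun _ => le_rfl)).trans ?_
    refine mul_le_mul_of_nonneg_left ?_ (rr_nonneg hw Δ y x)
    rw [add_sub_cancel, hE]
    refine mul_le_mul_of_nonneg_left (Real.exp_le_exp.2 ?_) (by positivity)
    rw [← Finset.mul_sum]
    exact mul_le_mul (by linarith) (sum_qq_le hw hm y)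
      (Finset.sum_nonneg fun x _ => qq_nonneg hw y x) (Real.exp_pos _).le
  have hE0 : 0 ≤ E := by positivity
  calc _ ≤ ∏ y, (1 + Real.exp (-(b * θ)) * (rr w Δ y x * E)) :=
        Finset.prod_le_prod (fun y _ => Ex_nonneg (pe_nonneg hw) (pe_le_one hw) fun ω => by
          have := mul_nonneg (Real.exp_pos (-(b * θ))).le
            (mul_nonneg (ind_nonneg (RemE w Δ ω y x)) (Real.exp_pos (2 * b * Ud w ω y)).le)
          linarith) fun y _ => hbound y
    _ ≤ Real.exp (∑ y, Real.exp (-(b * θ)) * (rr w Δ y x * E)) :=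
        one_add_prod_le _ _ fun y => mul_nonneg (Real.exp_pos _).le
          (mul_nonneg (rr_nonneg hw Δ y x) hE0)
    _ ≤ Real.exp 1 := by
        apply Real.exp_le_exp.2
        rw [← Finset.mul_sum, ← Finset.sum_mul]
        refine le_trans (mul_le_mul_of_nonneg_left (mul_le_mul_of_nonneg_right
          (sum_rr_le hw hΔ hm x) hE0) (Real.exp_pos _).le) hθ

lemma row_exp {w : Fin N → ℝ} (hw : ∀ x, 0 < w x) (Δ : ℝ) (b η : ℝ) (hb : 0 ≤ b)
    (y : Fin N) (X : Finset (Fin N)) (hη : ∀ x, qq w y x ≤ η)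
    (hX : X.card * (Real.exp (2 * b) * η) ≤ 1) :
    Ex (pe w) (fun ω => Real.exp (2 * b * ∑ x ∈ X, ind (RemE w Δ ω y x))) ≤
      Real.exp (Real.exp (2 * b) ^ 2 * Real.exp 1 * ∑ x ∈ X, rr w Δ y x) := by
  classical
  have hb1 : 0 ≤ Real.exp (2 * b) - 1 := by linarith [Real.add_one_le_exp (2 * b)]
  set g : Fin N → ℝ := fun x => if x ∈ X then Real.exp (2 * b) - 1 else 0 with hg
  have hg0 : ∀ x, 0 ≤ g x := fun x => by rw [hg]; dsimp only; split_ifs <;> linarith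
  have hgG : ∀ x, g x ≤ Real.exp (2 * b) - 1 := fun x => by
    rw [hg]; dsimp only; split_ifs <;> linarith
  set P : (EdgeIdx N → Bool) → ℝ := fun ω => ∏ x, (1 + g x * xi' w y x ω) with hP
  have hPe : ∀ ω, P ω = Real.exp (2 * b * ∑ x ∈ X, xi' w y x ω) := by
    intro ω
    rw [Finset.mul_sum, Real.exp_sum, hP]
    dsimp only
    rw [← Finset.prod_ite_mem_eq X]
    refine Finset.prod_congr rfl fun x _ => ?_
    by_cases h : x ∈ X
    · simp only [hg, h, if_true]; exact (exp_ind _ _).symm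
    · simp only [hg, h, if_false]; simp
  have step1 : Ex (pe w) (fun ω => Real.exp (2 * b * ∑ x ∈ X, ind (RemE w Δ ω y x))) ≤
      Ex (pe w) (fun ω => 1 + ∑ x ∈ X, ind (RemE w Δ ω y x) * P ω) := by
    refine Ex_mono (pe_nonneg hw) (pe_le_one hw) fun ω => ?_
    have hP0 : 0 ≤ P ω := by rw [hPe]; exact (Real.exp_pos _).le
    have hnn : ∀ x ∈ X, 0 ≤ ind (RemE w Δ ω y x) * P ω := fun x _ =>
      mul_nonneg (ind_nonneg _) hP0
    by_cases h : ∃ x ∈ X, RemE w Δ ω y x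
    · obtain ⟨x, hx, hr⟩ := h
      have h1 := Finset.single_le_sum hnn hx
      rw [ind_true hr, one_mul] at h1
      have h2 : Real.exp (2 * b * ∑ x ∈ X, ind (RemE w Δ ω y x)) ≤ P ω := by
        rw [hPe]
        apply Real.exp_le_exp.2
        refine mul_le_mul_of_nonneg_left (Finset.sum_le_sum fun x _ => ?_) (by linarith)
        exact ind_mono fun h => ⟨h.1, h.2.1⟩
      linarith
    · push Not at h
      have : ∑ x ∈ X, ind (RemE w Δ ω y x) = 0 :=
        Finset.sum_eq_zero fun x hx => ind_false (h x hx)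
      rw [this, mul_zero, Real.exp_zero]
      linarith [Finset.sum_nonneg hnn]
  refine step1.trans ?_
  rw [Ex_add, Ex_one, Ex_sum]
  have hgq : ∑ x, g x * qq w y x ≤ 1 := by
    have e1 : ∑ x, g x * qq w y x = ∑ x ∈ X, (Real.exp (2 * b) - 1) * qq w y x := by
      rw [← Finset.sum_ite_mem_eq X]
      refine Finset.sum_congr rfl fun x _ => ?_
      by_cases h : x ∈ X <;> simp [hg, h]
    rw [e1]
    refine le_trans (Finset.sum_le_card_nsmul X _ (Real.exp (2 * b) * η) fun x _ => ?_) ?_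
    · exact mul_le_mul (by linarith) (hη x) (qq_nonneg hw y x) (Real.exp_pos _).le
    · rw [nsmul_eq_mul]; exact hX
  calc _ ≤ 1 + ∑ x ∈ X, rr w Δ y x * (Real.exp (2 * b) ^ 2 * Real.exp 1) := by
        refine add_le_add le_rfl (Finset.sum_le_sum fun x _ => ?_)
        refine (row_J hw Δ y x g (Real.exp (2 * b) - 1) hg0 hgG).trans ?_
        refine mul_le_mul_of_nonneg_left ?_ (rr_nonneg hw Δ y x)
        rw [add_sub_cancel]
        exact mul_le_mul_of_nonneg_left (Real.exp_le_exp.2 hgq) (by positivity)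
    _ ≤ _ := by
        rw [← Finset.sum_mul, add_comm, mul_comm]
        exact Real.add_one_le_exp _

lemma prob_E1 {w : Fin N → ℝ} (hw : ∀ x, 0 < w x) {Δ : ℝ} (hΔ : 0 < Δ)
    (hm : ∑ z, w z ^ 2 ≤ Δ * ∑ z, w z) (b t θ η k : ℝ) (hb : 0 ≤ b)
    (hη : ∀ y x, qq w y x ≤ η) (hη0 : 0 ≤ η) (hk : k * (Real.exp (2 * b) * η) ≤ 1)
    (hθ : 2 * b + Real.exp (2 * b) ^ 2 * Real.exp 1 * (2 * Δ ^ 2) ≤ b * θ) (y : Fin N) :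
    Ex (pe w) (fun ω => ind (Ud w ω y ≤ k ∧
      t < ∑ x, ind (RemE w Δ ω y x ∧ θ ≤ InR w Δ ω x) * InR w Δ ω x)) ≤
      Real.exp (Δ - b * t) := by
  classical
  refine (markov hw _ (fun ω => ind (Ud w ω y ≤ k) * Real.exp
    (b * ∑ x, ind (RemE w Δ ω y x ∧ θ ≤ InR w Δ ω x) * InR w Δ ω x)) (b * t)
    (fun ω => mul_nonneg (ind_nonneg _) (Real.exp_pos _).le)
    (fun ω h => by
      rw [ind_true h.1, one_mul]
      exact Real.exp_le_exp.2 (mul_le_mul_of_nonneg_left h.2.le hb))).trans ?_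
  rw [sub_eq_neg_add, Real.exp_add]
  refine mul_le_mul_of_nonneg_left ?_ (Real.exp_pos _).le
  set F : Finset (Fin N) → Fin N → (EdgeIdx N → Bool) → ℝ := fun X y' ω =>
    if y' = y then ∏ x ∈ X, xi' w y x ω else
      Real.exp (2 * b * ∑ x ∈ X, ind (RemE w Δ ω y' x)) with hF
  set XX : Finset (Finset (Fin N)) :=
    (Finset.univ : Finset (Fin N)).powerset.filter (fun X => (X.card : ℝ) ≤ k) with hXX
  set c := Real.exp (-(b * θ) + 2 * b) with hc
  have hF0 : ∀ X y' ω, 0 ≤ F X y' ω := by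
    intro X y' ω
    simp only [hF]
    split_ifs
    · exact Finset.prod_nonneg fun x _ => ind_nonneg _
    · exact (Real.exp_pos _).le
  -- pointwise bound
  have step1 : Ex (pe w) (fun ω => ind (Ud w ω y ≤ k) * Real.exp
      (b * ∑ x, ind (RemE w Δ ω y x ∧ θ ≤ InR w Δ ω x) * InR w Δ ω x)) ≤
      Ex (pe w) (fun ω => ∑ X ∈ XX, c ^ X.card * ∏ y', F X y' ω) := by
    refine Ex_mono (pe_nonneg hw) (pe_le_one hw) fun ω => ?_
    have hnn : ∀ X ∈ XX, 0 ≤ c ^ X.card * ∏ y', F X y' ω := fun X _ =>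
      mul_nonneg (pow_nonneg (Real.exp_pos _).le _) (Finset.prod_nonneg fun y' _ => hF0 X y' ω)
    by_cases hU : Ud w ω y ≤ k
    · rw [ind_true hU, one_mul]
      have s1 : Real.exp (b * ∑ x, ind (RemE w Δ ω y x ∧ θ ≤ InR w Δ ω x) * InR w Δ ω x) ≤
          ∏ x, (1 + xi' w y x ω * Real.exp (-(b * θ) + 2 * b * InR w Δ ω x)) := by
        rw [Finset.mul_sum, Real.exp_sum]
        refine Finset.prod_le_prod (fun _ _ => (Real.exp_pos _).le) fun x _ => ?_
        by_cases h : RemE w Δ ω y x ∧ θ ≤ InR w Δ ω x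
        · rw [ind_true h, show xi' w y x ω = 1 from ind_true ⟨h.1.1, h.1.2.1⟩, one_mul, one_mul]
          have : Real.exp (b * InR w Δ ω x) ≤ Real.exp (-(b * θ) + 2 * b * InR w Δ ω x) := by
            apply Real.exp_le_exp.2; nlinarith [h.2]
          linarith
        · rw [ind_false h, zero_mul, mul_zero, Real.exp_zero]
          have := mul_nonneg (ind_nonneg (up w y x ∧ Adj ω y x))
            (Real.exp_pos (-(b * θ) + 2 * b * InR w Δ ω x)).le
          unfold xi'; linarith
      refine s1.trans ?_
      rw [Finset.prod_one_add, hXX, Finset.sum_filter]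
      refine Finset.sum_le_sum fun X _ => ?_
      rw [Finset.prod_mul_distrib]
      by_cases hall : ∀ x ∈ X, xi' w y x ω = 1
      · have hcard : (X.card : ℝ) ≤ k := by
          refine le_trans ?_ hU
          calc (X.card : ℝ) = ∑ x ∈ X, xi' w y x ω := by
                rw [Finset.sum_congr rfl hall]; simp
            _ ≤ ∑ x, xi' w y x ω := Finset.sum_le_sum_of_subset_of_nonneg
                (Finset.subset_univ _) fun x _ _ => ind_nonneg _
        rw [if_pos hcard]
        rw [← Finset.mul_prod_erase Finset.univ (fun y' => F X y' ω) (Finset.mem_univ y)]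
        have f1 : F X y ω = ∏ x ∈ X, xi' w y x ω := by simp [hF]
        rw [f1, mul_left_comm]
        refine mul_le_mul_of_nonneg_left ?_ (Finset.prod_nonneg fun x _ => ind_nonneg _)
        have f2 : ∏ y' ∈ Finset.univ.erase y, F X y' ω =
            Real.exp (∑ y' ∈ Finset.univ.erase y, 2 * b * ∑ x ∈ X, ind (RemE w Δ ω y' x)) := by
          rw [Real.exp_sum]
          refine Finset.prod_congr rfl fun y' hy' => ?_
          have := Finset.ne_of_mem_erase hy'
          simp [hF, this]
        rw [f2, ← Real.exp_sum, hc, ← Real.exp_nat_mul, ← Real.exp_add]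
        apply Real.exp_le_exp.2
        have f3 : ∑ x ∈ X, InR w Δ ω x = ∑ x ∈ X, ind (RemE w Δ ω y x) +
            ∑ y' ∈ Finset.univ.erase y, ∑ x ∈ X, ind (RemE w Δ ω y' x) := by
          rw [Finset.add_sum_erase Finset.univ (fun y' => ∑ x ∈ X, ind (RemE w Δ ω y' x))
            (Finset.mem_univ y), Finset.sum_comm]
          rfl
        have f4 : ∑ x ∈ X, ind (RemE w Δ ω y x) ≤ X.card := by
          refine (Finset.sum_le_card_nsmul X _ 1 fun x _ => ind_le_one _).trans ?_
          simp
        rw [Finset.sum_add_distrib, Finset.sum_const, nsmul_eq_mul, ← Finset.mul_sum, f3,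
          ← Finset.mul_sum]
        nlinarith [mul_le_mul_of_nonneg_left f4 hb]
      · push Not at hall
        obtain ⟨x, hx, hx'⟩ := hall
        have : xi' w y x ω = 0 := (xi_cases w y x ω).resolve_right hx'
        rw [Finset.prod_eq_zero hx this, zero_mul]
        split_ifs
        · exact mul_nonneg (pow_nonneg (Real.exp_pos _).le _)
            (Finset.prod_nonneg fun y' _ => hF0 X y' ω)
        · exact le_rfl
    · rw [ind_false hU, zero_mul]
      exact Finset.sum_nonneg hnn
  refine step1.trans ?_
  rw [Ex_sum]
  -- termwise expectation
  have step2 : ∀ X ∈ XX, Ex (pe w) (fun ω => c ^ X.card * ∏ y', F X y' ω) ≤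
      ∏ x ∈ X, qq w y x := by
    intro X hX
    have hcard : (X.card : ℝ) ≤ k := (Finset.mem_filter.1 hX).2
    rw [Ex_const_mul, Ex_rows (pe w) (lo w) (F X)]
    · rw [← Finset.mul_prod_erase Finset.univ _ (Finset.mem_univ y)]
      have g1 : Ex (pe w) (F X y) = ∏ x ∈ X, qq w y x := by
        have e1 : F X y = fun ω => ∏ x, ((if x ∈ X then 0 else 1) +
            (if x ∈ X then 1 else 0) * xi' w y x ω) := by
          funext ω
          simp only [hF, if_true]
          rw [← Finset.prod_ite_mem_eq]
          refine Finset.prod_congr rfl fun x _ => ?_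
          by_cases h : x ∈ X <;> simp [h]
        rw [e1, Ex_row_prod, ← Finset.prod_ite_mem_eq X]
        refine Finset.prod_congr rfl fun x _ => ?_
        by_cases h : x ∈ X <;> simp [h]
      have hXη : X.card * (Real.exp (2 * b) * η) ≤ 1 :=
        (mul_le_mul_of_nonneg_right hcard (mul_nonneg (Real.exp_pos _).le hη0)).trans hk
      have g2 : ∏ y' ∈ Finset.univ.erase y, Ex (pe w) (F X y') ≤
          Real.exp (X.card * (Real.exp (2 * b) ^ 2 * Real.exp 1 * (2 * Δ ^ 2))) := by
        calc ∏ y' ∈ Finset.univ.erase y, Ex (pe w) (F X y') ≤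
            ∏ y' ∈ Finset.univ.erase y,
              Real.exp (Real.exp (2 * b) ^ 2 * Real.exp 1 * ∑ x ∈ X, rr w Δ y' x) := by
              refine Finset.prod_le_prod (fun y' _ =>
                Ex_nonneg (pe_nonneg hw) (pe_le_one hw) (hF0 X y')) fun y' hy' => ?_
              have hne := Finset.ne_of_mem_erase hy'
              have : F X y' = fun ω => Real.exp (2 * b * ∑ x ∈ X, ind (RemE w Δ ω y' x)) := by
                funext ω; simp [hF, hne]
              rw [this]
              exact row_exp hw Δ b η hb y' X (hη y') hXη
          _ = Real.exp (Real.exp (2 * b) ^ 2 * Real.exp 1 *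
              ∑ x ∈ X, ∑ y' ∈ Finset.univ.erase y, rr w Δ y' x) := by
              rw [← Real.exp_sum, ← Finset.mul_sum, Finset.sum_comm]
          _ ≤ _ := by
              apply Real.exp_le_exp.2
              rw [mul_left_comm]
              refine mul_le_mul_of_nonneg_left ?_ (by positivity)
              rw [← nsmul_eq_mul]
              refine Finset.sum_le_card_nsmul X _ _ fun x _ => ?_
              exact (Finset.sum_le_sum_of_subset_of_nonneg (Finset.erase_subset _ _)
                fun y' _ _ => rr_nonneg hw Δ y' x).trans (sum_rr_le hw hΔ hm x)
      rw [g1, mul_left_comm]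
      refine mul_le_of_le_one_right (Finset.prod_nonneg fun x _ => qq_nonneg hw y x) ?_
      refine (mul_le_mul_of_nonneg_left g2 (pow_nonneg (Real.exp_pos _).le _)).trans ?_
      rw [← Real.exp_nat_mul, ← Real.exp_add, Real.exp_le_one_iff, ← mul_add]
      exact mul_nonpos_of_nonneg_of_nonpos (Nat.cast_nonneg _) (by linarith)
    · intro y' ω ω' h
      simp only [hF]
      split_ifs with hy
      · subst hy
        exact Finset.prod_congr rfl fun x _ => xi_dep w y' x ω ω' fun e he _ => h e he
      · congr 2
        exact Finset.sum_congr rfl fun x _ => rem_dep w Δ y' x ω ω' h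
  calc _ ≤ ∑ X ∈ XX, ∏ x ∈ X, qq w y x := Finset.sum_le_sum step2
    _ ≤ ∑ X ∈ (Finset.univ : Finset (Fin N)).powerset, ∏ x ∈ X, qq w y x :=
        Finset.sum_le_sum_of_subset_of_nonneg (Finset.filter_subset _ _)
          fun X _ _ => Finset.prod_nonneg fun x _ => qq_nonneg hw y x
    _ = ∏ x, (1 + qq w y x) := by rw [Finset.prod_one_add]
    _ ≤ Real.exp (∑ x, qq w y x) := one_add_prod_le _ _ fun x => qq_nonneg hw y x
    _ ≤ Real.exp Δ := Real.exp_le_exp.2 (sum_qq_le hw hm y)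

end GRG
namespace GRG

variable {N : ℕ}

open Classical in
lemma pd_le {w : Fin N → ℝ} (hw : ∀ x, 0 < w x) (x y : Fin N) :
    (if y = x then 0 else pGRG w x y) ≤ w x * w y / ∑ z, w z := by
  have h0 : 0 < ∑ z, w z := Finset.sum_pos (fun z _ => hw z) ⟨x, Finset.mem_univ _⟩
  have h1 := hw x
  have h2 := hw y
  split_ifs
  · positivity
  · exact pG_le hw x y

open Classical in
lemma pd_nonneg {w : Fin N → ℝ} (hw : ∀ x, 0 < w x) (x y : Fin N) :
    0 ≤ (if y = x then 0 else pGRG w x y) := by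
  split_ifs
  · exact le_rfl
  · exact pG_nonneg hw x y

lemma prob_E3 {w : Fin N → ℝ} (hw : ∀ x, 0 < w x) (b t : ℝ) (hb : 1 ≤ b) (x : Fin N) :
    Ex (pe w) (fun ω => ind (Real.exp b * w x + t < deg ω x)) ≤ Real.exp (-(b * t)) := by
  classical
  have h0 : 0 < ∑ z, w z := Finset.sum_pos (fun z _ => hw z) ⟨x, Finset.mem_univ _⟩
  refine (markov hw _ (fun ω => Real.exp (b * deg ω x)) (b * (Real.exp b * w x + t))
    (fun ω => (Real.exp_pos _).le)
    (fun ω h => Real.exp_le_exp.2 (mul_le_mul_of_nonneg_left h.le (by linarith)))).trans ?_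
  have e1 : (fun ω : EdgeIdx N → Bool => Real.exp (b * deg ω x)) =
      fun ω => ∏ y, (1 + (Real.exp b - 1) * ind (Adj ω x y)) := by
    funext ω
    rw [deg_eq, Finset.mul_sum, Real.exp_sum]
    exact Finset.prod_congr rfl fun y _ => exp_ind _ _
  have hb1 : 0 ≤ Real.exp b - 1 := by linarith [Real.add_one_le_exp b]
  have hs : ∑ y, (if y = x then 0 else pGRG w x y) ≤ w x := by
    calc _ ≤ ∑ y, w x * w y / ∑ z, w z := Finset.sum_le_sum fun y _ => pd_le hw x y
      _ = w x := by rw [← Finset.sum_div, ← Finset.mul_sum]; field_simp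
  rw [e1, Ex_deg_prod w x (fun _ => 1) (fun _ => Real.exp b - 1)]
  calc _ ≤ Real.exp (-(b * (Real.exp b * w x + t))) * Real.exp (Real.exp b * w x) := by
        refine mul_le_mul_of_nonneg_left ?_ (Real.exp_pos _).le
        refine (one_add_prod_le _ _ fun y => mul_nonneg hb1 (pd_nonneg hw x y)).trans ?_
        rw [← Finset.mul_sum]
        apply Real.exp_le_exp.2
        exact mul_le_mul (by linarith) hs
          (Finset.sum_nonneg fun y _ => pd_nonneg hw x y) (Real.exp_pos _).le
    _ ≤ _ := by
        rw [← Real.exp_add]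
        apply Real.exp_le_exp.2
        have : 0 ≤ Real.exp b * w x := mul_nonneg (Real.exp_pos _).le (hw x).le
        nlinarith

lemma prob_E4 {w : Fin N → ℝ} (hw : ∀ x, 0 < w x) (x : Fin N)
    (h1 : ∀ y, w x * w y ≤ ∑ z, w z) (h2 : 2 * w x ≤ ∑ z, w z) :
    Ex (pe w) (fun ω => ind ((16 : ℝ) * deg ω x < w x)) ≤ Real.exp (-(w x / 16)) := by
  classical
  have h0 : 0 < ∑ z, w z := Finset.sum_pos (fun z _ => hw z) ⟨x, Finset.mem_univ _⟩
  set S := ∑ z, w z with hS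
  have hx := hw x
  refine (markov hw _ (fun ω => Real.exp (-1 * deg ω x)) (-(w x / 16))
    (fun ω => (Real.exp_pos _).le)
    (fun ω h => Real.exp_le_exp.2 (by linarith))).trans ?_
  have e1 : (fun ω : EdgeIdx N → Bool => Real.exp (-1 * deg ω x)) =
      fun ω => ∏ y, (1 + (Real.exp (-1) - 1) * ind (Adj ω x y)) := by
    funext ω
    rw [deg_eq, Finset.mul_sum, Real.exp_sum]
    exact Finset.prod_congr rfl fun y _ => exp_ind _ _
  have he : Real.exp (-1) ≤ 1 / 2 := by
    rw [Real.exp_neg, one_div]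
    exact inv_anti₀ (by norm_num) (by linarith [Real.add_one_le_exp (1 : ℝ)])
  have hs : w x / 4 ≤ ∑ y, (if y = x then 0 else pGRG w x y) := by
    calc w x / 4 ≤ (∑ y, w x * w y / (2 * S)) - w x * w x / (2 * S) := by
          rw [← Finset.sum_div, ← Finset.mul_sum, ← hS, ← sub_div,
            le_div_iff₀ (by positivity)]
          nlinarith
      _ = ∑ y, (if y = x then 0 else w x * w y / (2 * S)) := by
          rw [← Finset.add_sum_erase Finset.univ _ (Finset.mem_univ x),
            ← Finset.add_sum_erase Finset.univ (fun y => if y = x then 0 else w x * w y / (2 * S))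
              (Finset.mem_univ x)]
          rw [if_pos rfl, zero_add, add_sub_cancel_left]
          refine Finset.sum_congr rfl fun y hy => ?_
          rw [if_neg (Finset.ne_of_mem_erase hy)]
      _ ≤ _ := by
          refine Finset.sum_le_sum fun y _ => ?_
          split_ifs
          · exact le_rfl
          · unfold pGRG
            have := mul_pos hx (hw y)
            apply div_le_div_of_nonneg_left this.le (by positivity)
            have := h1 y
            linarith
  rw [e1, Ex_deg_prod w x (fun _ => 1) (fun _ => Real.exp (-1) - 1)]
  calc _ ≤ Real.exp (-(-(w x / 16))) * Real.exp (-(w x / 8)) := by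
        refine mul_le_mul_of_nonneg_left ?_ (Real.exp_pos _).le
        calc _ ≤ ∏ y, Real.exp ((Real.exp (-1) - 1) * (if y = x then 0 else pGRG w x y)) := by
              refine Finset.prod_le_prod (fun y _ => ?_) fun y _ => ?_
              · have hp0 := pd_nonneg hw x y
                have hp1 : (if y = x then 0 else pGRG w x y) ≤ 1 := by
                  split_ifs
                  · norm_num
                  · exact pG_le_one hw x y
                have := Real.exp_pos (-1)
                nlinarith
              · linarith [Real.add_one_le_exp
                  ((Real.exp (-1) - 1) * (if y = x then 0 else pGRG w x y))]
          _ ≤ _ := by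
              rw [← Real.exp_sum, ← Finset.mul_sum]
              apply Real.exp_le_exp.2
              nlinarith
    _ = _ := by
        rw [← Real.exp_add]; congr 1; ring

lemma prob_E5 {w : Fin N → ℝ} (hw : ∀ x, 0 < w x) {Δ : ℝ} (hΔ : 0 < Δ)
    (hm : ∑ z, w z ^ 2 ≤ Δ * ∑ z, w z) (X : ℝ) (x : Fin N) :
    Ex (pe w) (fun ω => ind (X * w x < Δ * ∑ y, ind (Adj ω y x ∧ Δ * w y ≤ w x) * w y)) ≤
      Real.exp (2 * Δ ^ 2 - X) := by
  classical
  have h0 : 0 < ∑ z, w z := Finset.sum_pos (fun z _ => hw z) ⟨x, Finset.mem_univ _⟩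
  set S := ∑ z, w z with hS
  have hx := hw x
  set c : Fin N → ℝ := fun y => Δ / w x * (ind (Δ * w y ≤ w x) * w y) with hc
  have hc0 : ∀ y, 0 ≤ c y := fun y =>
    mul_nonneg (by positivity) (mul_nonneg (ind_nonneg _) (hw y).le)
  have hc1 : ∀ y, c y ≤ 1 := by
    intro y
    simp only [hc]
    by_cases h : Δ * w y ≤ w x
    · rw [ind_true h, one_mul, div_mul_eq_mul_div, div_le_one hx]; exact h
    · rw [ind_false h]; simp
  have hc2 : ∀ y, c y ≤ Δ / w x * w y := fun y =>
    mul_le_mul_of_nonneg_left (mul_le_of_le_one_left (hw y).le (ind_le_one _)) (by positivity)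
  have esum : ∀ ω : EdgeIdx N → Bool, ∑ y, c y * ind (Adj ω x y) =
      Δ * (∑ y, ind (Adj ω y x ∧ Δ * w y ≤ w x) * w y) / w x := by
    intro ω
    rw [Finset.mul_sum, Finset.sum_div]
    refine Finset.sum_congr rfl fun y _ => ?_
    simp only [hc]
    by_cases h1 : Adj ω x y <;> by_cases h2 : Δ * w y ≤ w x
    · rw [ind_true h1, ind_true h2, ind_true ⟨(adj_symm _ _ _).1 h1, h2⟩]; field_simp
    · rw [ind_false h2, ind_false (P := Adj ω y x ∧ Δ * w y ≤ w x) (fun h => h2 h.2)]; simp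
    · rw [ind_false h1, ind_false (P := Adj ω y x ∧ Δ * w y ≤ w x) (fun h => h1 ((adj_symm _ _ _).1 h.1))]; simp
    · rw [ind_false h2, ind_false (P := Adj ω y x ∧ Δ * w y ≤ w x) (fun h => h2 h.2)]; simp
  refine (markov hw _ (fun ω => Real.exp (∑ y, c y * ind (Adj ω x y))) X
    (fun ω => (Real.exp_pos _).le)
    (fun ω h => Real.exp_le_exp.2 (by
      rw [esum, le_div_iff₀ hx]; exact h.le))).trans ?_
  have e1 : (fun ω : EdgeIdx N → Bool => Real.exp (∑ y, c y * ind (Adj ω x y))) =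
      fun ω => ∏ y, (1 + (Real.exp (c y) - 1) * ind (Adj ω x y)) := by
    funext ω
    rw [Real.exp_sum]
    exact Finset.prod_congr rfl fun y _ => exp_ind _ _
  rw [e1, Ex_deg_prod w x (fun _ => 1) (fun y => Real.exp (c y) - 1), sub_eq_neg_add (2 * Δ ^ 2),
    Real.exp_add]
  refine mul_le_mul_of_nonneg_left ?_ (Real.exp_pos _).le
  have hec : ∀ y, 0 ≤ Real.exp (c y) - 1 := fun y => by
    linarith [Real.add_one_le_exp (c y), hc0 y]
  refine (one_add_prod_le _ _ fun y => mul_nonneg (hec y) (pd_nonneg hw x y)).trans ?_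
  apply Real.exp_le_exp.2
  calc _ ≤ ∑ y, 2 * Δ * (w y ^ 2 / S) := by
        refine Finset.sum_le_sum fun y _ => ?_
        have hy := hw y
        have h5 : Real.exp (c y) - 1 ≤ 2 * (Δ / w x * w y) := by
          have := Real.abs_exp_sub_one_le (x := c y) (by rw [abs_of_nonneg (hc0 y)]; exact hc1 y)
          rw [abs_of_nonneg (hc0 y)] at this
          linarith [le_abs_self (Real.exp (c y) - 1), hc2 y]
        calc _ ≤ 2 * (Δ / w x * w y) * (w x * w y / S) :=
              mul_le_mul h5 (pd_le hw x y) (pd_nonneg hw x y) (by positivity)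
          _ = _ := by field_simp
    _ = 2 * Δ * ((∑ y, w y ^ 2) / S) := by rw [← Finset.mul_sum, Finset.sum_div]
    _ ≤ 2 * Δ * Δ := by
        apply mul_le_mul_of_nonneg_left _ (by linarith)
        rw [div_le_iff₀ h0]; exact hm
    _ = _ := by ring

lemma union_bound {w : Fin N → ℝ} (hw : ∀ x, 0 < w x)
    (P : Fin N → (EdgeIdx N → Bool) → Prop) (B : ℝ)
    (h : ∀ x, Ex (pe w) (fun ω => ind (P x ω)) ≤ B) :
    Ex (pe w) (fun ω => ind (∃ x, P x ω)) ≤ N * B := by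
  calc _ ≤ Ex (pe w) (fun ω => ∑ x, ind (P x ω)) := by
        refine Ex_mono (pe_nonneg hw) (pe_le_one hw) fun ω => ?_
        by_cases hx : ∃ x, P x ω
        · rw [ind_true hx]
          obtain ⟨x, hx⟩ := hx
          have := Finset.single_le_sum (f := fun x => ind (P x ω))
            (fun x _ => ind_nonneg _) (Finset.mem_univ x)
          simp only [ind_true hx] at this
          exact this
        · rw [ind_false hx]; exact Finset.sum_nonneg fun _ _ => ind_nonneg _
    _ = ∑ x, Ex (pe w) (fun ω => ind (P x ω)) := Ex_sum _ _ _
    _ ≤ ∑ _x : Fin N, B := Finset.sum_le_sum fun x _ => h x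
    _ = N * B := by simp

lemma prob_good {w : Fin N → ℝ} (hw : ∀ x, 0 < w x) {Δ : ℝ} (hΔ : 0 < Δ)
    (hm : ∑ z, w z ^ 2 ≤ Δ * ∑ z, w z) (b L C θi θo η X B : ℝ) (hb : 1 ≤ b)
    (hη : ∀ x y, w x * w y ≤ η * ∑ z, w z) (hη0 : 0 ≤ η) (hη1 : η ≤ 1)
    (h2 : ∀ x, 2 * w x ≤ ∑ z, w z)
    (hk : C * L ^ 2 * (Real.exp (2 * b) * η) ≤ 1)
    (hθi : 2 * b + Real.exp (2 * b) ^ 2 * Real.exp 1 * (2 * Δ ^ 2) ≤ b * θi)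
    (hθo : Real.exp (-(b * θo)) * (2 * Δ ^ 2 * (Real.exp (2 * b) ^ 2 *
      Real.exp (Real.exp (2 * b) * Δ))) ≤ 1)
    (hB1 : Real.exp (Δ - b * (C * L ^ 2)) ≤ B)
    (hB2 : Real.exp (1 - b * (C * L ^ 2)) ≤ B)
    (hB3 : Real.exp (Real.exp b * Δ - b * (C * L ^ 2)) ≤ B)
    (hB4 : Real.exp (-(b * (C * L ^ 2))) ≤ B)
    (hB5 : Real.exp (-(X / 16)) ≤ B)
    (hB6 : Real.exp (2 * Δ ^ 2 - X) ≤ B) :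
    Ex (pe w) (fun ω => ind (¬ Good w Δ L C (Real.exp b) θi θo X ω)) ≤ N * (6 * B) := by
  have hb0 : 0 ≤ b := by linarith
  have key : ∀ ω, ¬ Good w Δ L C (Real.exp b) θi θo X ω → ∃ x,
      (Ud w ω x ≤ C * L ^ 2 ∧
        C * L ^ 2 < ∑ z, ind (RemE w Δ ω x z ∧ θi ≤ InR w Δ ω z) * InR w Δ ω z) ∨
      (C * L ^ 2 < ∑ y, ind (RemE w Δ ω y x ∧ θo ≤ Ud w ω y) * Ud w ω y) ∨
      (C * L ^ 2 < Ud w ω x) ∨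
      (Real.exp b * w x + C * L ^ 2 < deg ω x) ∨
      (X ≤ w x ∧ (16 : ℝ) * deg ω x < w x) ∨
      (X * w x < Δ * ∑ y, ind (Adj ω y x ∧ Δ * w y ≤ w x) * w y) := by
    intro ω hng
    by_contra hcon
    push Not at hcon
    apply hng
    refine ⟨fun y => (hcon y).1 (hcon y).2.2.1, fun x => (hcon x).2.1, fun x => (hcon x).2.2.1,
      fun x => (hcon x).2.2.2.1, fun x => (hcon x).2.2.2.2.1, fun x => (hcon x).2.2.2.2.2⟩
  have hqη : ∀ y x, qq w y x ≤ η := by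
    intro y x
    have h0 : 0 < ∑ z, w z := Finset.sum_pos (fun z _ => hw z) ⟨x, Finset.mem_univ _⟩
    refine (qq_le hw y x).trans ?_
    rw [div_le_iff₀ h0]; exact hη y x
  have ind_or : ∀ P Q : Prop, ind (P ∨ Q) ≤ ind P + ind Q := by
    intro P Q
    by_cases hP : P
    · rw [ind_true (Or.inl hP), ind_true hP]; linarith [ind_nonneg Q]
    · by_cases hQ : Q
      · rw [ind_true (Or.inr hQ), ind_true hQ]; linarith [ind_nonneg P]
      · rw [ind_false (by tauto)]; linarith [ind_nonneg P, ind_nonneg Q]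
  refine (Ex_mono (pe_nonneg hw) (pe_le_one hw) fun ω => ind_mono (key ω)).trans ?_
  refine union_bound hw _ _ fun x => ?_
  have hsplit : ∀ (P Q : (EdgeIdx N → Bool) → Prop) (a c : ℝ),
      Ex (pe w) (fun ω => ind (P ω)) ≤ a → Ex (pe w) (fun ω => ind (Q ω)) ≤ c →
      Ex (pe w) (fun ω => ind (P ω ∨ Q ω)) ≤ a + c := by
    intro P Q a c hP hQ
    refine (Ex_mono (pe_nonneg hw) (pe_le_one hw) fun ω => ind_or _ _).trans ?_
    rw [Ex_add]; linarith
  have e : 6 * B = B + (B + (B + (B + (B + B)))) := by ring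
  rw [e]
  refine hsplit _ _ _ _ ((prob_E1 hw hΔ hm b _ θi η _ hb0 hqη hη0 hk hθi x).trans hB1) ?_
  refine hsplit _ _ _ _ ((prob_E2 hw hΔ hm b _ θo hb0 hθo x).trans hB2) ?_
  refine hsplit _ _ _ _ ((prob_U hw hm b _ hb0 x).trans hB3) ?_
  refine hsplit _ _ _ _ ((prob_E3 hw b _ hb x).trans hB4) ?_
  refine hsplit _ _ _ _ ?_ ((prob_E5 hw hΔ hm X x).trans hB6)
  by_cases hX : X ≤ w x
  · refine (Ex_mono (pe_nonneg hw) (pe_le_one hw) fun ω => ind_mono fun h => h.2).trans ?_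
    refine (prob_E4 hw x (fun y => (hη x y).trans ?_) (h2 x)).trans
      (le_trans (Real.exp_le_exp.2 (by linarith)) hB5)
    have h0 : 0 < ∑ z, w z := Finset.sum_pos (fun z _ => hw z) ⟨x, Finset.mem_univ _⟩
    exact mul_le_of_le_one_left h0.le hη1
  · have : (fun ω : EdgeIdx N → Bool => ind (X ≤ w x ∧ (16 : ℝ) * deg ω x < w x)) =
        fun _ => 0 * 1 := by
      funext ω; rw [ind_false (fun h => hX h.1)]; ring
    rw [this, Ex_const_mul, zero_mul]
    exact (Real.exp_pos _).le.trans hB5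

end GRG
namespace GRG

/-- The numerical relations between the parameters, valid for large `l = log N`. -/
structure Num (ε δ δ' c ν C0 l : ℝ) : Prop where
  l1 : 1 ≤ l
  u1 : 64 ≤ l ^ c
  u2 : 16 * (ν + 1) ≤ l ^ c
  LL1 : 1 ≤ Real.log l
  b1 : 1 ≤ c * Real.log l
  LLu : Real.log l ≤ l ^ c
  hC0 : C0 * l ^ δ ≤ l ^ δ'
  hex : (ν + 2) / c * l ^ 2 * Real.exp (-(ε * l)) ≤ 1

lemma num_eventually (ε δ δ' c ν C0 : ℝ) (hε : 0 < ε) (hδ : δ < δ') (hc : 0 < c) :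
    ∀ᶠ l : ℝ in Filter.atTop, Num ε δ δ' c ν C0 l := by
  have t1 := tendsto_rpow_atTop hc
  have t2 := tendsto_rpow_atTop (sub_pos.2 hδ)
  have t3 := Real.tendsto_log_atTop
  have t4 := (isLittleO_log_rpow_atTop hc).bound (show (0 : ℝ) < 1 by norm_num)
  have t5 : Filter.Tendsto (fun l : ℝ => (ν + 2) / c * l ^ 2 * Real.exp (-(ε * l)))
      Filter.atTop (nhds 0) := by
    have := (tendsto_rpow_mul_exp_neg_mul_atTop_nhds_zero 2 ε hε).const_mul ((ν + 2) / c)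
    rw [mul_zero] at this
    refine this.congr fun l => ?_
    rw [show ((2 : ℝ)) = ((2 : ℕ) : ℝ) by norm_num, Real.rpow_natCast]
    push_cast
    rw [neg_mul]; ring
  filter_upwards [Filter.eventually_ge_atTop (1 : ℝ), t1.eventually_ge_atTop 64,
    t1.eventually_ge_atTop (16 * (ν + 1)), t3.eventually_ge_atTop 1,
    t3.eventually_ge_atTop (1 / c), t4, t2.eventually_ge_atTop C0,
    t5.eventually_le_const (show (0 : ℝ) < 1 by norm_num)] with l h1 h2 h3 h4 h5 h6 h7 h8
  have hl : 0 < l := by linarith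
  refine ⟨h1, h2, h3, h4, ?_, ?_, ?_, h8⟩
  · rw [div_le_iff₀ hc] at h5; linarith
  · rw [Real.norm_of_nonneg (by linarith), Real.norm_of_nonneg (by positivity)] at h6
    linarith
  · calc C0 * l ^ δ ≤ l ^ (δ' - δ) * l ^ δ :=
          mul_le_mul_of_nonneg_right h7 (by positivity)
      _ = l ^ δ' := by rw [← Real.rpow_add hl]; ring_nf

set_option maxHeartbeats 2000000 in
/-- Measure bound in the large `N` regime. -/
lemma large_N {N : ℕ} (ε δ δ' c ν C0 : ℝ) (hε : 0 < ε) (hε2 : ε < 1 / 2)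
    (hc : 0 < c) (hc1 : c ≤ 1) (hcδ : 20 * c ≤ δ') (hcδ2 : 3 * δ' + 20 * c ≤ 1) (hν : 0 < ν)
    (hN : 4 ≤ N) (w : Fin N → ℝ) (hpos : ∀ x, 0 < w x)
    (hA1 : ∀ x, w x ≤ (N : ℝ) ^ ((1 : ℝ) / 2 - ε))
    (hm1 : (N : ℝ) ^ (-ε) ≤ m1 w)
    (hm2 : m2 w / m1 w ≤ C0 * Real.log N ^ δ)
    (hn : Num ε δ δ' c ν C0 (Real.log N)) :
    1 - ENNReal.ofReal (6 * (N : ℝ) ^ (-ν)) ≤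
        grgMeasure w {ω |
          ∀ (hA : (adjMatrix ω).IsHermitian) (σ : Equiv.Perm (Fin N)),
            Antitone (hA.eigenvalues ∘ σ) →
            ∀ perm : Equiv.Perm (Fin N),
              (∀ i j : Fin N, i < j → precA (Adj ω) (perm j) (perm i)) →
              ∀ i : Fin N,
                (50 * (50 * ((ν + 2) / c + 1)) *
                    Real.sqrt (Real.log N / Real.log (Real.log N)) <
                    hA.eigenvalues (σ i) →
                  |hA.eigenvalues (σ i) - Real.sqrt (deg ω (perm i))| ≤
                    50 * (50 * ((ν + 2) / c + 1)) *
                      Real.sqrt (Real.log N / Real.log (Real.log N))) ∧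
                (hA.eigenvalues (σ i) <
                    -(50 * (50 * ((ν + 2) / c + 1)) *
                      Real.sqrt (Real.log N / Real.log (Real.log N))) →
                  |hA.eigenvalues (σ i) + Real.sqrt (deg ω (perm i.rev))| ≤
                    50 * (50 * ((ν + 2) / c + 1)) *
                      Real.sqrt (Real.log N / Real.log (Real.log N)))} := by
  obtain ⟨l1, u1, u2, LL1, b1, LLu, hC0, hex⟩ := hn
  have hN4 : (4 : ℝ) ≤ N := by exact_mod_cast hN
  have hN0 : (0 : ℝ) < N := by linarith
  set l := Real.log N with hl
  set LL := Real.log l with hLL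
  have hl0 : 0 < l := by linarith
  set Δ := l ^ δ' with hΔ
  have hexpc : ∀ s : ℝ, Real.exp (s * LL) = l ^ s := fun s => by
    rw [Real.rpow_def_of_pos hl0, mul_comm]
  set u := l ^ c with hu
  set L := Real.sqrt (l / LL) with hL
  have hLL0 : 0 < LL := by linarith
  have hL0 : 0 < L := Real.sqrt_pos.2 (by positivity)
  have hL2 : L ^ 2 = l / LL := Real.sq_sqrt (by positivity)
  have hΔ0 : 0 < Δ := by positivity
  have hu0 : 0 < u := by positivity
  have hbu : Real.exp (c * LL) = u := hexpc c
  have hbu2 : Real.exp (2 * (c * LL)) = u ^ 2 := by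
    rw [← hbu, ← Real.exp_nat_mul]; norm_num
  have hu20 : u ^ 20 = l ^ (20 * c) := by
    rw [hu, ← Real.rpow_natCast, ← Real.rpow_mul hl0.le]; congr 1; push_cast; ring
  have hΔ3 : Δ ^ 3 = l ^ (3 * δ') := by
    rw [hΔ, ← Real.rpow_natCast, ← Real.rpow_mul hl0.le]; congr 1; push_cast; ring
  have huΔ : u ^ 20 ≤ Δ := by
    rw [hu20]; exact Real.rpow_le_rpow_of_exponent_le l1 hcδ
  have hΔl : Δ ^ 3 * u ^ 20 ≤ l := by
    rw [hu20, hΔ3, ← Real.rpow_add hl0]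
    calc _ ≤ l ^ (1 : ℝ) := Real.rpow_le_rpow_of_exponent_le l1 hcδ2
      _ = l := Real.rpow_one l
  have hu1 : 1 ≤ u := by linarith
  have hpow : ∀ k : ℕ, k ≤ 20 → u ^ k ≤ Δ := fun k hk =>
    (pow_le_pow_right₀ hu1 hk).trans huΔ
  have hΔu1 : u ≤ Δ := by simpa using hpow 1 (by norm_num)
  have hΔ1 : 1 ≤ Δ := by linarith
  have hΔpow : ∀ j k : ℕ, j ≤ 3 → k ≤ 20 → Δ ^ j * u ^ k ≤ l := fun j k hj hk =>
    (mul_le_mul (pow_le_pow_right₀ hΔ1 hj) (pow_le_pow_right₀ hu1 hk) (by positivity)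
      (by positivity)).trans hΔl
  set C := (ν + 2) / c with hC
  have hCc : C * c = ν + 2 := by rw [hC]; field_simp
  have hC1 : 1 ≤ C := by rw [hC, le_div_iff₀ hc]; linarith
  have hbCL : c * LL * (C * L ^ 2) = (ν + 2) * l := by
    rw [hL2, ← hCc]; field_simp
  have hL2l : L ^ 2 ≤ l := by rw [hL2]; exact div_le_self hl0.le LL1
  have hleL2 : ∀ a, a * LL ≤ l → a ≤ L ^ 2 := fun a ha => by
    rw [hL2, le_div_iff₀ hLL0]; exact ha
  set S := ∑ z, w z with hS
  have hm1e : m1 w = S / N := rfl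
  have hSN : (N : ℝ) ^ (1 - ε) ≤ S := by
    rw [hm1e, le_div_iff₀ hN0] at hm1
    calc (N : ℝ) ^ (1 - ε) = (N : ℝ) ^ (-ε) * N := by
          rw [sub_eq_neg_add, Real.rpow_add hN0, Real.rpow_one]
      _ ≤ S := hm1
  have hS0 : 0 < S := lt_of_lt_of_le (by positivity) hSN
  have hm : ∑ z, w z ^ 2 ≤ Δ * S := by
    have h := hm2.trans hC0
    have e : m2 w / m1 w = (∑ z, w z ^ 2) / S := by
      rw [hm1e]; unfold m2; field_simp
    rw [e, div_le_iff₀ hS0] at h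
    exact h
  have hNe : (N : ℝ) ^ (-ε) = Real.exp (-(ε * l)) := by
    rw [Real.rpow_def_of_pos hN0]; congr 1; ring
  have hη : ∀ x y, w x * w y ≤ Real.exp (-(ε * l)) * S := fun x y => by
    calc w x * w y ≤ (N : ℝ) ^ ((1 : ℝ) / 2 - ε) * (N : ℝ) ^ ((1 : ℝ) / 2 - ε) :=
          mul_le_mul (hA1 x) (hA1 y) (hpos y).le (by positivity)
      _ = (N : ℝ) ^ (-ε) * (N : ℝ) ^ (1 - ε) := by
          rw [← Real.rpow_add hN0, ← Real.rpow_add hN0]; congr 1; ring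
      _ ≤ _ := by rw [← hNe]; exact mul_le_mul_of_nonneg_left hSN (by positivity)
  have h2 : ∀ x, 2 * w x ≤ S := fun x => by
    have h4 : (2 : ℝ) ≤ (N : ℝ) ^ ((1 : ℝ) / 2) := by
      rw [← Real.sqrt_eq_rpow]
      exact Real.le_sqrt_of_sq_le (by linarith)
    calc 2 * w x ≤ (N : ℝ) ^ ((1 : ℝ) / 2) * (N : ℝ) ^ ((1 : ℝ) / 2 - ε) :=
          mul_le_mul h4 (hA1 x) (hpos x).le (by positivity)
      _ = (N : ℝ) ^ (1 - ε) := by rw [← Real.rpow_add hN0]; congr 1; ring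
      _ ≤ S := hSN
  set B := Real.exp (-((ν + 1) * l)) with hB
  have hΔl1 : Δ ≤ l := by simpa using hΔpow 1 0 (by norm_num) (by norm_num)
  have huΔl : u * Δ ≤ l := by
    have := hΔpow 1 1 (by norm_num) (by norm_num)
    simp only [pow_one] at this; linarith
  have hΔsql : 2 * Δ ^ 2 ≤ l := by
    have := hΔpow 2 1 (by norm_num) (by norm_num)
    simp only [pow_one] at this; nlinarith [sq_nonneg Δ]
  have hu2l : u ^ 2 ≤ l := by simpa using hΔpow 0 2 (by norm_num) (by norm_num)
  have hνl : 0 ≤ ν * l := by positivity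
  have hP := prob_good hpos hΔ0 hm (c * LL) L C (Δ ^ 2 * u ^ 5) (Δ * u ^ 5)
    (Real.exp (-(ε * l))) (16 * (ν + 1) * l) B b1 hη (Real.exp_pos _).le
    (Real.exp_le_one_iff.2 (by nlinarith)) h2
    (by
      rw [hbu2]
      refine le_trans ?_ hex
      have : L ^ 2 * u ^ 2 ≤ l ^ 2 := by
        rw [sq l]; exact mul_le_mul hL2l hu2l (by positivity) hl0.le
      calc C * L ^ 2 * (u ^ 2 * Real.exp (-(ε * l)))
          = C * (L ^ 2 * u ^ 2) * Real.exp (-(ε * l)) := by ring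
        _ ≤ _ := by gcongr)
    (by
      rw [hbu2]
      have he : Real.exp 1 ≤ 3 := Real.exp_one_lt_three.le
      have h1 : 1 ≤ Δ ^ 2 * u ^ 4 := one_le_mul_of_one_le_of_one_le
        (one_le_pow₀ hΔ1) (one_le_pow₀ hu1)
      have h3 : Δ ^ 2 * u ^ 4 * 64 ≤ Δ ^ 2 * u ^ 4 * u :=
        mul_le_mul_of_nonneg_left u1 (by positivity)
      have h4 : (u ^ 2) ^ 2 * Real.exp 1 * (2 * Δ ^ 2) ≤ 6 * (Δ ^ 2 * u ^ 4) := by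
        calc (u ^ 2) ^ 2 * Real.exp 1 * (2 * Δ ^ 2)
            = Real.exp 1 * (2 * (Δ ^ 2 * u ^ 4)) := by ring
          _ ≤ 3 * (2 * (Δ ^ 2 * u ^ 4)) := by gcongr
          _ = _ := by ring
      have h5 : c * LL * (Δ ^ 2 * u ^ 4 * 64) ≤ c * LL * (Δ ^ 2 * u ^ 4 * u) :=
        mul_le_mul_of_nonneg_left h3 (by positivity)
      have h6 : c * LL * 1 ≤ c * LL * (Δ ^ 2 * u ^ 4) :=
        mul_le_mul_of_nonneg_left h1 (by positivity)
      have h7 : 1 * (Δ ^ 2 * u ^ 4) ≤ c * LL * (Δ ^ 2 * u ^ 4) :=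
        mul_le_mul_of_nonneg_right b1 (by positivity)
      have h8 : c * LL * (Δ ^ 2 * u ^ 5) = c * LL * (Δ ^ 2 * u ^ 4 * u) := by ring
      linarith)
    (by
      rw [hbu2]
      have k1 : Δ ≤ Real.exp Δ := by linarith [Real.add_one_le_exp Δ]
      have k2 : u ≤ Real.exp u := by linarith [Real.add_one_le_exp u]
      have k3 : (2 : ℝ) ≤ Real.exp 1 := by linarith [Real.add_one_le_exp (1 : ℝ)]
      have k4 : 2 * Δ ^ 2 * ((u ^ 2) ^ 2 * Real.exp (u ^ 2 * Δ)) ≤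
          Real.exp (1 + 2 * Δ + 4 * u + u ^ 2 * Δ) := by
        calc 2 * Δ ^ 2 * ((u ^ 2) ^ 2 * Real.exp (u ^ 2 * Δ))
            ≤ Real.exp 1 * Real.exp Δ ^ 2 *
              ((Real.exp u ^ 2) ^ 2 * Real.exp (u ^ 2 * Δ)) := by gcongr
          _ = _ := by
            rw [← pow_mul, ← Real.exp_nat_mul, ← Real.exp_nat_mul, ← Real.exp_add,
              ← Real.exp_add, ← Real.exp_add]
            congr 1; push_cast; ring
      calc _ ≤ Real.exp (-(c * LL * (Δ * u ^ 5))) *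
            Real.exp (1 + 2 * Δ + 4 * u + u ^ 2 * Δ) := by gcongr
        _ ≤ 1 := by
          rw [← Real.exp_add]
          refine Real.exp_le_one_iff.2 ?_
          have q1 : 1 * (Δ * u ^ 5) ≤ c * LL * (Δ * u ^ 5) :=
            mul_le_mul_of_nonneg_right b1 (by positivity)
          have q2 : 64 ≤ u ^ 3 := by
            calc (64 : ℝ) ≤ u := u1
              _ = u ^ 1 := (pow_one u).symm
              _ ≤ u ^ 3 := pow_le_pow_right₀ hu1 (by norm_num)
          have q3 : Δ * u ^ 2 * 64 ≤ Δ * u ^ 2 * u ^ 3 :=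
            mul_le_mul_of_nonneg_left q2 (by positivity)
          have q4 : Δ * 1 ≤ Δ * u ^ 2 :=
            mul_le_mul_of_nonneg_left (one_le_pow₀ hu1) hΔ0.le
          have q5 : Δ * u ^ 5 = Δ * u ^ 2 * u ^ 3 := by ring
          linarith)
    (Real.exp_le_exp.2 (by rw [hbCL]; linarith))
    (Real.exp_le_exp.2 (by rw [hbCL]; linarith))
    (Real.exp_le_exp.2 (by rw [hbCL, hbu]; linarith))
    (Real.exp_le_exp.2 (by rw [hbCL]; linarith))
    (Real.exp_le_exp.2 (by linarith))
    (Real.exp_le_exp.2 (by linarith))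
  rw [hbu] at hP
  have hNB : (N : ℝ) * (6 * B) = 6 * (N : ℝ) ^ (-ν) := by
    have e1 : (N : ℝ) = Real.exp l := (Real.exp_log hN0).symm
    have e2 : (N : ℝ) ^ (-ν) = Real.exp (-(ν * l)) := by
      rw [Real.rpow_def_of_pos hN0]; congr 1; ring
    rw [e2, e1, hB]
    rw [show Real.exp l * (6 * Real.exp (-((ν + 1) * l))) =
      6 * (Real.exp l * Real.exp (-((ν + 1) * l))) by ring, ← Real.exp_add]
    congr 2; ring
  rw [hNB] at hP
  refine measure_of_Ex hpos _ _ (le_trans ?_ hP)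
  refine Ex_mono (pe_nonneg hpos) (pe_le_one hpos) fun ω => ind_mono fun hω hg => hω ?_
  intro hH σ hσ perm hperm i
  have hKLL : 16 * (ν + 1) * LL ≤ u ^ 2 := by
    rw [sq]; exact mul_le_mul u2 LLu hLL0.le hu0.le
  refine det_main w hpos Δ L C u (Δ ^ 2 * u ^ 5) (Δ * u ^ 5) (16 * (ν + 1) * l) hΔ0 hL0 hC1
    hu0.le (by positivity) (by positivity) (by positivity) ?_ ?_ ?_ ?_ ?_ ω hg hH σ hσ perm
    hperm i
  · apply hleL2
    calc Δ ^ 2 * u ^ 5 * (Δ * u ^ 5) * LL ≤ Δ ^ 2 * u ^ 5 * (Δ * u ^ 5) * u := by gcongr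
      _ = Δ ^ 3 * u ^ 11 := by ring
      _ ≤ l := hΔpow 3 11 (by norm_num) (by norm_num)
  · apply hleL2
    calc Δ ^ 2 * u ^ 5 * LL ≤ Δ ^ 2 * u ^ 5 * u := by gcongr
      _ = Δ ^ 2 * u ^ 6 := by ring
      _ ≤ l := hΔpow 2 6 (by norm_num) (by norm_num)
  · rw [hL2, ← mul_div_assoc, le_div_iff₀ hLL0]
    calc u * (16 * (ν + 1) * l) * LL = u * (16 * (ν + 1) * LL) * l := by ring
      _ ≤ u * u ^ 2 * l := by gcongr
      _ = u ^ 3 * l := by ring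
      _ ≤ Δ * l := mul_le_mul_of_nonneg_right (hpow 3 (by norm_num)) hl0.le
  · rw [show L ^ 4 = (L ^ 2) ^ 2 by ring, hL2, div_pow, ← mul_div_assoc,
      le_div_iff₀ (by positivity)]
    calc u * (16 * (ν + 1) * l) ^ 2 * LL ^ 2 = u * (16 * (ν + 1) * LL) ^ 2 * l ^ 2 := by ring
      _ ≤ u * (u ^ 2) ^ 2 * l ^ 2 := by gcongr
      _ = u ^ 5 * l ^ 2 := by ring
      _ ≤ Δ * l ^ 2 := mul_le_mul_of_nonneg_right (hpow 5 (by norm_num)) (by positivity)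
  · calc 64 * u ≤ u * u := mul_le_mul_of_nonneg_right u1 hu0.le
      _ = u ^ 2 := by ring
      _ ≤ Δ := hpow 2 (by norm_num)

end GRG
open GRG in
/-- Extremal eigenvalues are square roots of the largest degrees.
Under (A1) and (A2), for every `ν > 0` there is `C_ν > 0` such that with `ν`-high
probability, for every `i`: if `λ_i(A) > C_ν √(log N/log log N)` then
`|λ_i(A) − √(D_{π(i)})| ≤ C_ν √(log N/log log N)`, and if
`λ_i(A) < −C_ν √(log N/log log N)` then
`|λ_i(A) + √(D_{π(N+1−i)})| ≤ C_ν √(log N/log log N)`.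
Here the ordered eigenvalues are encoded as any antitone enumeration of the spectrum,
and `π` is the unique permutation enumerating the vertices decreasingly for `≺`. -/
theorem extremal_eigenvalues
    (ε δ : ℝ) (hε : 0 < ε) (hε' : ε < 1 / 2) (hδ : 0 < δ) (hδ' : δ < 1 / 3)
    (w : (N : ℕ) → Fin N → ℝ)
    (hpos : ∀ N x, 0 < w N x)
    (hA1 : ∀ N x, w N x ≤ (N : ℝ) ^ ((1 : ℝ) / 2 - ε))
    (hA2m1 : ∀ N : ℕ, 1 ≤ N → (N : ℝ) ^ (-ε) ≤ m1 (w N))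
    (hA2m2 : ∃ C > 0, ∀ N : ℕ, 2 ≤ N → m2 (w N) / m1 (w N) ≤ C * Real.log N ^ δ)
    (ν : ℝ) (hν : 0 < ν) :
    ∃ Cν > (0 : ℝ), ∃ C > (0 : ℝ), ∀ N : ℕ,
      1 - ENNReal.ofReal (C * (N : ℝ) ^ (-ν)) ≤
        grgMeasure (w N) {ω |
          ∀ (hA : (adjMatrix ω).IsHermitian) (σ : Equiv.Perm (Fin N)),
            Antitone (hA.eigenvalues ∘ σ) →
            ∀ perm : Equiv.Perm (Fin N),
              (∀ i j : Fin N, i < j → precA (Adj ω) (perm j) (perm i)) →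
              ∀ i : Fin N,
                (Cν * Real.sqrt (Real.log N / Real.log (Real.log N)) <
                    hA.eigenvalues (σ i) →
                  |hA.eigenvalues (σ i) - Real.sqrt (deg ω (perm i))| ≤
                    Cν * Real.sqrt (Real.log N / Real.log (Real.log N))) ∧
                (hA.eigenvalues (σ i) <
                    -(Cν * Real.sqrt (Real.log N / Real.log (Real.log N))) →
                  |hA.eigenvalues (σ i) + Real.sqrt (deg ω (perm i.rev))| ≤
                    Cν * Real.sqrt (Real.log N / Real.log (Real.log N)))} := by
  obtain ⟨C0, hC0, hm2⟩ := hA2m2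
  set δ1 : ℝ := (δ + 1 / 3) / 2 with hδ1
  set c : ℝ := min ((1 - 3 * δ1) / 20) (δ1 / 20) with hc
  have c1 : c ≤ (1 - 3 * δ1) / 20 := min_le_left _ _
  have c2 : c ≤ δ1 / 20 := min_le_right _ _
  have c0 : 0 < c := lt_min (by linarith) (by linarith)
  have hev : ∀ᶠ N : ℕ in Filter.atTop, Num ε δ δ1 c ν C0 (Real.log N) :=
    (Real.tendsto_log_atTop.comp tendsto_natCast_atTop_atTop).eventually
      (num_eventually ε δ δ1 c ν C0 hε (by linarith) c0)
  obtain ⟨N0, hN0⟩ := Filter.eventually_atTop.1 hev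
  have hCC : 0 < (ν + 2) / c := by positivity
  refine ⟨50 * (50 * ((ν + 2) / c + 1)), by positivity,
    6 + ((max N0 4 : ℕ) : ℝ) ^ ν, by positivity, fun N => ?_⟩
  by_cases hN : max N0 4 ≤ N
  · have h4 : 4 ≤ N := (le_max_right _ _).trans hN
    refine le_trans ?_ (large_N ε δ δ1 c ν C0 hε hε' c0 (by linarith) (by linarith)
      (by linarith) hν h4 (w N) (hpos N) (hA1 N) (hA2m1 N (by omega)) (hm2 N (by omega))
      (hN0 N ((le_max_left _ _).trans hN)))
    refine tsub_le_tsub_left (ENNReal.ofReal_le_ofReal ?_) _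
    refine mul_le_mul_of_nonneg_right ?_ (by positivity)
    have : (0 : ℝ) ≤ ((max N0 4 : ℕ) : ℝ) ^ ν := by positivity
    linarith
  · rcases Nat.eq_zero_or_pos N with h0 | h0
    · subst h0
      refine measure_of_Ex (hpos 0) _ _ ?_
      refine le_trans (b := Ex (pe (w 0)) (fun _ => 0)) ?_ ?_
      · refine Ex_mono (pe_nonneg (hpos 0)) (pe_le_one (hpos 0)) fun ω => ?_
        rw [ind_false]
        intro h
        exact h fun _ _ _ _ _ i => i.elim0
      · rw [show Ex (pe (w 0)) (fun _ => 0) = 0 by simp [Ex]]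
        positivity
    · have hNpos : (0 : ℝ) < N := by exact_mod_cast h0
      have hle : (N : ℝ) ≤ ((max N0 4 : ℕ) : ℝ) := by
        exact_mod_cast (not_le.1 hN).le
      have h1 : 1 ≤ (6 + ((max N0 4 : ℕ) : ℝ) ^ ν) * (N : ℝ) ^ (-ν) := by
        rw [Real.rpow_neg hNpos.le, ← div_eq_mul_inv, le_div_iff₀ (by positivity), one_mul]
        have := Real.rpow_le_rpow hNpos.le hle hν.le
        linarith
      have h2 : 1 - ENNReal.ofReal ((6 + ((max N0 4 : ℕ) : ℝ) ^ ν) * (N : ℝ) ^ (-ν)) = 0 := by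
        apply tsub_eq_zero_of_le
        rw [← ENNReal.ofReal_one]
        exact ENNReal.ofReal_le_ofReal h1
      rw [h2]
      exact zero_le
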